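/- arXiv:0803.0998 — 2 statements merged into one kernel-verified Lean document; each statement's English description precedes it below -/
import Mathlib

section
/- Let R be a commutative noetherian ring and C a semidualizing R-module. If M is a G_C-flat R-module and N is an R-module of finite C-flat C-cotorsion projective dimension, then Ext_R^i(M,N) = 0 for all i ≥ 1. -/
open CategoryTheory TensorProduct

universe u

section
variable (R : Type u) [CommRing R]

def extZero (M N : ModuleCat.{u} R) : Prop :=
  ∀ i : ℕ, 1 ≤ i → Subsingleton (((Ext R (ModuleCat.{u} R) i).obj (Opposite.op M)).obj N)

def torZero (M N : ModuleCat.{u} R) : Prop :=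
  ∀ i : ℕ, 1 ≤ i → Subsingleton (((Tor (ModuleCat.{u} R) i).obj M).obj N)

def IsSemidualizing (C : ModuleCat.{u} R) : Prop :=
  Module.Finite R C ∧ Function.Bijective (LinearMap.lsmul R C) ∧ extZero R C C

/-- A module is `C`-flat if it is isomorphic to `F ⊗[R] C` with `F` flat. -/
def IsCFlat (C M : ModuleCat.{u} R) : Prop :=
  ∃ F : ModuleCat.{u} R, Module.Flat R F ∧ Nonempty (M ≃ₗ[R] (F ⊗[R] C))

def IsCInjective (C M : ModuleCat.{u} R) : Prop :=
  ∃ I : ModuleCat.{u} R, Module.Injective R I ∧ Nonempty (M ≃ₗ[R] (↥C →ₗ[R] ↥I))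

/-- cotorsion: `Ext^{≥1}(F, N) = 0` for all flat `F`. -/
def IsCotorsion (N : ModuleCat.{u} R) : Prop :=
  ∀ F : ModuleCat.{u} R, Module.Flat R F → extZero R F N

/-- `C`-cotorsion: `Ext^{≥1}(F ⊗ C, N) = 0` for all flat `F`. -/
def IsCCotorsion (C N : ModuleCat.{u} R) : Prop :=
  ∀ F : ModuleCat.{u} R, Module.Flat R F →
    extZero R (ModuleCat.of R (↥F ⊗[R] ↥C)) N

/-- `C`-flat `C`-cotorsion: isomorphic to `F ⊗ C` with `F` flat and cotorsion. -/
def IsCFlatCotorsion (C M : ModuleCat.{u} R) : Prop :=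
  ∃ F : ModuleCat.{u} R, Module.Flat R F ∧ IsCotorsion R F ∧
    Nonempty (M ≃ₗ[R] (F ⊗[R] C))

/-- The natural evaluation map `C ⊗ Hom(C,M) → M`. -/
noncomputable def evalMap (C M : ModuleCat.{u} R) :
    (↥C ⊗[R] (↥C →ₗ[R] ↥M)) →ₗ[R] ↥M :=
  TensorProduct.lift (LinearMap.id (R := R) (M := ↥C →ₗ[R] ↥M)).flip

/-- The Bass class `B_C(R)`. -/
noncomputable def InBassClass (C M : ModuleCat.{u} R) : Prop :=
  extZero R C M ∧
  torZero R C (ModuleCat.of R (↥C →ₗ[R] ↥M)) ∧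
  Function.Bijective (evalMap R C M)

/-- A `ℤ`-indexed complex of `R`-modules: `d i : X (i+1) → X i`. -/
structure ZComplex where
  X : ℤ → ModuleCat.{u} R
  d : ∀ i : ℤ, ↥(X (i + 1)) →ₗ[R] ↥(X i)
  d_comp_d : ∀ i : ℤ, (d i).comp (d (i + 1)) = 0

namespace ZComplex

variable {R} (Z : ZComplex R)

/-- Exactness of the complex. -/
def IsExact : Prop := ∀ i : ℤ, Function.Exact (Z.d (i + 1)) (Z.d i)

/-- Exactness of `Z ⊗[R] J`. -/
def TensorExact (J : ModuleCat.{u} R) : Prop :=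
  ∀ i : ℤ, Function.Exact (LinearMap.rTensor (↥J) (Z.d (i + 1)))
    (LinearMap.rTensor (↥J) (Z.d i))

/-- Exactness of `Hom_R(V, Z)`. -/
def HomFromExact (V : ModuleCat.{u} R) : Prop :=
  ∀ i : ℤ, Function.Exact
    (fun f : ↥V →ₗ[R] ↥(Z.X (i + 1 + 1)) => (Z.d (i + 1)).comp f)
    (fun f : ↥V →ₗ[R] ↥(Z.X (i + 1)) => (Z.d i).comp f)

/-- Exactness of `Hom_R(Z, V)`. -/
def HomToExact (V : ModuleCat.{u} R) : Prop :=
  ∀ i : ℤ, Function.Exact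
    (fun g : ↥(Z.X i) →ₗ[R] ↥V => g.comp (Z.d i))
    (fun g : ↥(Z.X (i + 1)) →ₗ[R] ↥V => g.comp (Z.d (i + 1)))

/-- `M ≅ Coker(∂₁)`. -/
def IsCokerOfD1 (M : ModuleCat.{u} R) : Prop :=
  Nonempty (↥M ≃ₗ[R] (↥(Z.X 0) ⧸ LinearMap.range (Z.d 0)))

end ZComplex

end

section
variable (R : Type u) [CommRing R]

/-- A complete `FF_C`-resolution witnessing that `M` is `G_C`-flat. -/
def IsGCFlat (C M : ModuleCat.{u} R) : Prop :=
  ∃ Z : ZComplex R, Z.IsExact ∧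
    (∀ i : ℤ, 0 ≤ i → Module.Flat R (Z.X i)) ∧
    (∀ i : ℤ, i < 0 → IsCFlat R C (Z.X i)) ∧
    (∀ J : ModuleCat.{u} R, IsCInjective R C J → Z.TensorExact J) ∧
    Z.IsCokerOfD1 M

def IsCProjective (C M : ModuleCat.{u} R) : Prop :=
  ∃ P : ModuleCat.{u} R, Module.Projective R P ∧ Nonempty (M ≃ₗ[R] (P ⊗[R] C))

/-- A complete `PP_C`-resolution witnessing that `M` is `G_C`-projective. -/
def IsGCProjective (C M : ModuleCat.{u} R) : Prop :=
  ∃ Z : ZComplex R, Z.IsExact ∧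
    (∀ i : ℤ, 0 ≤ i → Module.Projective R (Z.X i)) ∧
    (∀ i : ℤ, i < 0 → IsCProjective R C (Z.X i)) ∧
    (∀ Q : ModuleCat.{u} R, IsCProjective R C Q → Z.HomToExact Q) ∧
    Z.IsCokerOfD1 M

/-- `G(𝒳)` for a class `𝒳` of modules. -/
def GClass (𝒳 : ModuleCat.{u} R → Prop) (M : ModuleCat.{u} R) : Prop :=
  ∃ Z : ZComplex R, Z.IsExact ∧
    (∀ i : ℤ, 𝒳 (Z.X i)) ∧
    (∀ V : ModuleCat.{u} R, 𝒳 V → Z.HomFromExact V) ∧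
    (∀ V : ModuleCat.{u} R, 𝒳 V → Z.HomToExact V) ∧
    Z.IsCokerOfD1 M

/-- Iterates `G^n(𝒳)`, with `G^0(𝒳) = 𝒳`. -/
def GIter : ℕ → (ModuleCat.{u} R → Prop) → (ModuleCat.{u} R → Prop)
  | 0, 𝒳 => 𝒳
  | n + 1, 𝒳 => GClass R (GIter n 𝒳)

/-- `H_C(𝒳)`: modules with a `P_C F_C^cot`-complete `𝒳`-resolution. -/
def HClass (C : ModuleCat.{u} R) (𝒳 : ModuleCat.{u} R → Prop) (M : ModuleCat.{u} R) : Prop :=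
  ∃ Z : ZComplex R, Z.IsExact ∧
    (∀ i : ℤ, 𝒳 (Z.X i)) ∧
    (∀ P : ModuleCat.{u} R, Module.Projective R P →
      Z.HomFromExact (ModuleCat.of R (↥P ⊗[R] ↥C))) ∧
    (∀ N : ModuleCat.{u} R, IsCFlatCotorsion R C N → Z.HomToExact N) ∧
    Z.IsCokerOfD1 M

/-- Iterates `H_C^n(𝒳)`, with `H_C^0(𝒳) = 𝒳`. -/
def HIter (C : ModuleCat.{u} R) : ℕ → (ModuleCat.{u} R → Prop) → (ModuleCat.{u} R → Prop)
  | 0, 𝒳 => 𝒳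
  | n + 1, 𝒳 => HClass R C (HIter C n 𝒳)

/-- `M` admits a resolution `0 → X_n → ⋯ → X_0 → M → 0` with each `X_i` in `𝒳`. -/
def HasResOfLength (𝒳 : ModuleCat.{u} R → Prop) (n : ℕ) (M : ModuleCat.{u} R) : Prop :=
  ∃ (P : ℕ → ModuleCat.{u} R) (d : ∀ i : ℕ, ↥(P (i + 1)) →ₗ[R] ↥(P i))
    (ε : ↥(P 0) →ₗ[R] ↥M),
      Function.Surjective ε ∧ Function.Exact (d 0) ε ∧
      (∀ i : ℕ, Function.Exact (d (i + 1)) (d i)) ∧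
      (∀ i : ℕ, i ≤ n → 𝒳 (P i)) ∧
      (∀ i : ℕ, n < i → Subsingleton (P i))

/-- `M` admits a coresolution `0 → M → Y_0 → ⋯ → Y_n → 0` with each `Y_i` in `𝒳`. -/
def HasCoresOfLength (𝒳 : ModuleCat.{u} R → Prop) (n : ℕ) (M : ModuleCat.{u} R) : Prop :=
  ∃ (P : ℕ → ModuleCat.{u} R) (d : ∀ i : ℕ, ↥(P i) →ₗ[R] ↥(P (i + 1)))
    (η : ↥M →ₗ[R] ↥(P 0)),
      Function.Injective η ∧ Function.Exact η (d 0) ∧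
      (∀ i : ℕ, Function.Exact (d i) (d (i + 1))) ∧
      (∀ i : ℕ, i ≤ n → 𝒳 (P i)) ∧
      (∀ i : ℕ, n < i → Subsingleton (P i))

/-- `C` is a dualizing module: semidualizing of finite injective dimension. -/
def IsDualizing (C : ModuleCat.{u} R) : Prop :=
  IsSemidualizing R C ∧
  ∃ n : ℕ, HasCoresOfLength R (fun I => Module.Injective R ↥I) n C

end


section CharacterModuleLemmas

variable {R : Type u} [CommRing R]

namespace CharacterModule

/-- The evaluation map from a module to its double character module. -/
noncomputable def evalDual (A : Type u) [AddCommGroup A] [Module R A] :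
    A →ₗ[R] CharacterModule (CharacterModule A) :=
  curry ((CharacterModule.congr (TensorProduct.comm R (CharacterModule A) A))
    (uncurry LinearMap.id))

variable {A B I : Type u} [AddCommGroup A] [Module R A] [AddCommGroup B] [Module R B]
  [AddCommGroup I] [Module R I]

lemma evalDual_injective : Function.Injective (evalDual (R := R) A) :=
  (injective_iff_map_eq_zero _).2 fun _ h ↦
    eq_zero_of_character_apply fun c ↦ DFunLike.congr_fun h c

/-- A character factors through a linear map as soon as it vanishes on the kernel. -/
lemma exists_dual_eq_of_ker_le (f : A →ₗ[R] B) (c : CharacterModule A)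
    (h : ∀ a, f a = 0 → c a = 0) : ∃ c' : CharacterModule B, dual f c' = c := by
  let g : (A ⧸ LinearMap.ker f) →ₗ[R] B := (LinearMap.ker f).liftQ f le_rfl
  have hg : Function.Injective g :=
    LinearMap.ker_eq_bot.mp (Submodule.ker_liftQ_eq_bot _ _ _ le_rfl)
  let c₀ : CharacterModule (A ⧸ LinearMap.ker f) :=
    QuotientAddGroup.lift (LinearMap.ker f).toAddSubgroup c fun a ha ↦ h a ha
  obtain ⟨c', hc'⟩ := dual_surjective_of_injective g hg c₀
  exact ⟨c', DFunLike.ext _ _ fun a ↦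
    DFunLike.congr_fun hc' ((LinearMap.ker f).mkQ a)⟩

lemma dual_exact {D : Type u} [AddCommGroup D] [Module R D] {f : A →ₗ[R] B} {g : B →ₗ[R] D}
    (h : Function.Exact f g) : Function.Exact (dual g) (dual f) := by
  intro c
  constructor
  · intro hc
    refine exists_dual_eq_of_ker_le g c fun b hb ↦ ?_
    obtain ⟨a, rfl⟩ := (h b).mp hb
    exact DFunLike.congr_fun hc a
  · rintro ⟨c, rfl⟩
    refine DFunLike.ext _ _ fun a ↦ ?_
    change c (g (f a)) = 0
    rw [h.apply_apply_eq_zero, map_zero]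

variable (R A I) in
/-- The natural map `A ⊗ I⋆ → Hom(A, I)⋆`. -/
noncomputable def tensorDualHom :
    A ⊗[R] CharacterModule I →ₗ[R] CharacterModule (A →ₗ[R] I) :=
  TensorProduct.lift <| LinearMap.flip
    { toFun := fun c ↦
        { toFun := fun a ↦ dual (LinearMap.applyₗ a) c
          map_add' := fun a b ↦ DFunLike.ext _ _ fun f ↦ by
            change c (f (a + b)) = c (f a) + c (f b)
            simp
          map_smul' := fun r a ↦ DFunLike.ext _ _ fun f ↦ by
            change c (f (r • a)) = c (r • f a)
            simp }
      map_add' := fun c d ↦ rfl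
      map_smul' := fun r c ↦ rfl }

lemma tensorDualHom_naturality (g : A →ₗ[R] B) :
    (dual (g.lcomp R I)).comp (tensorDualHom R A I) =
      (tensorDualHom R B I).comp (g.rTensor (CharacterModule I)) := by
  ext
  rfl

lemma tensorDualHom_bijective_of_free [Module.Free R A] [Module.Finite R A] :
    Function.Bijective (tensorDualHom R A I) := by
  classical
  let b := Module.Free.chooseBasis R A
  let e := TensorProduct.equivFinsuppOfBasisLeft (N := CharacterModule I) b
  have key (d : _ →₀ CharacterModule I) (f : A →ₗ[R] I) :
      tensorDualHom R A I (e.symm d) f = ∑ i, d i (f (b i)) := by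
    have : e.symm d = ∑ i, b i ⊗ₜ[R] d i := by
      rw [TensorProduct.equivFinsuppOfBasisLeft_symm_apply, Finsupp.sum_fintype]
      simp
    rw [this, map_sum]
    exact map_sum (AddMonoidHom.eval f) (fun i ↦ tensorDualHom R A I (b i ⊗ₜ d i)) _
  rw [← e.symm.bijective.of_comp_iff]
  constructor
  · refine (injective_iff_map_eq_zero ((tensorDualHom R A I).comp e.symm.toLinearMap)).2
      fun d hd ↦ ?_
    ext i y
    have h := (key d (b.constr R (Pi.single i y))).symm.trans (DFunLike.congr_fun hd _)
    refine Eq.trans ?_ h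
    simp [Pi.single_apply, apply_ite]
  · intro c
    let d (i : Module.Free.ChooseBasisIndex R A) : CharacterModule I :=
      dual ((LinearMap.smulRightₗ (b.coord i))) c
    refine ⟨Finsupp.equivFunOnFinite.symm d, DFunLike.ext _ _ fun f ↦ ?_⟩
    refine (key _ f).trans ?_
    change ∑ i, c ((b.coord i).smulRight (f (b i))) = c f
    rw [← map_sum]
    congr 1
    exact b.ext fun j ↦ by simp [Finsupp.single_apply]

lemma tensorDualHom_surjective [Module.Finite R A] :
    Function.Surjective (tensorDualHom R A I) := by
  obtain ⟨n, p, hp⟩ := Module.Finite.exists_fin' R A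
  have h₁ : Function.Surjective (dual (p.lcomp R I)) :=
    dual_surjective_of_injective _ fun f g h ↦ LinearMap.ext fun a ↦ by
      obtain ⟨x, rfl⟩ := hp a
      exact LinearMap.congr_fun h x
  have h₂ := h₁.comp (tensorDualHom_bijective_of_free (A := Fin n → R) (I := I)).2
  rw [← LinearMap.coe_comp, tensorDualHom_naturality, LinearMap.coe_comp] at h₂
  exact h₂.of_comp

lemma tensorDualHom_bijective [Module.FinitePresentation R A] :
    Function.Bijective (tensorDualHom R A I) := by
  obtain ⟨n, p, hp⟩ := Module.Finite.exists_fin' R A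
  have : Module.Finite R (LinearMap.ker p) :=
    Module.Finite.iff_fg.mpr (Module.FinitePresentation.fg_ker p hp)
  obtain ⟨m, q, hq⟩ := Module.Finite.exists_fin' R (LinearMap.ker p)
  let k := (LinearMap.ker p).subtype.comp q
  have hk : Function.Exact k p := by
    rw [LinearMap.exact_iff, LinearMap.range_comp, LinearMap.range_eq_top.mpr hq,
      Submodule.map_top, Submodule.range_subtype]
  have hI : Function.Exact (p.lcomp R I) (k.lcomp R I) := by
    intro f
    constructor
    · intro hf
      have hle : LinearMap.ker p ≤ LinearMap.ker f := fun x hx ↦ by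
        obtain ⟨y, rfl⟩ := (hk x).mp hx
        exact LinearMap.congr_fun hf y
      refine ⟨((LinearMap.ker p).liftQ f hle).comp
        (p.quotKerEquivOfSurjective hp).symm.toLinearMap, LinearMap.ext fun x ↦ ?_⟩
      have : (p.quotKerEquivOfSurjective hp).symm (p x) = (LinearMap.ker p).mkQ x := by
        rw [LinearEquiv.symm_apply_eq]
        rfl
      simp [this]
    · rintro ⟨f, rfl⟩
      exact LinearMap.ext fun x ↦ by simp [hk.apply_apply_eq_zero]
  refine ⟨LinearMap.injective_of_surjective_of_injective_of_right_exact
    (k.rTensor (CharacterModule I)) (p.rTensor (CharacterModule I))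
    (dual (k.lcomp R I)) (dual (p.lcomp R I))
    (tensorDualHom R _ I) (tensorDualHom R _ I) (tensorDualHom R A I)
    (tensorDualHom_naturality k) (tensorDualHom_naturality p)
    (rTensor_exact _ hk hp) (dual_exact hI) tensorDualHom_surjective
    tensorDualHom_bijective_of_free.1 (LinearMap.rTensor_surjective _ hp),
    tensorDualHom_surjective⟩

/-- Over a noetherian ring, the character module of an injective module is flat. -/
lemma flat_of_injective [IsNoetherianRing R] (hI : Module.Injective R I) :
    Module.Flat R (CharacterModule I) := by
  rw [Module.Flat.iff_rTensor_injective']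
  intro a
  have h₁ : Function.Surjective (a.subtype.lcomp R I) :=
    (Module.Baer.iff_surjective).mp (Module.Baer.of_injective hI) a
  have : Module.FinitePresentation R a := Module.finitePresentation_of_finite R a
  have h₂ := (dual_injective_of_surjective _ h₁).comp
    (tensorDualHom_bijective (R := R) (A := a) (I := I)).1
  rw [← LinearMap.coe_comp, tensorDualHom_naturality, LinearMap.coe_comp] at h₂
  exact h₂.of_comp

/-- Over a noetherian ring, the double character module of a flat module is flat. -/
lemma flat_dual_dual [IsNoetherianRing R] [Module.Flat R A] :
    Module.Flat R (CharacterModule (CharacterModule A)) :=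
  flat_of_injective (Module.Flat.iff_characterModule_injective.mp ‹_›)

/-- Over a noetherian ring, the cokernel of a flat module in its double character module is
flat. -/
lemma flat_quotient_range_evalDual [IsNoetherianRing R] [Module.Flat R A] :
    Module.Flat R (CharacterModule (CharacterModule A) ⧸
      LinearMap.range (evalDual (R := R) A)) := by
  have : Module.Flat R (CharacterModule (CharacterModule A)) := flat_dual_dual
  rw [Module.Flat.iff_characterModule_injective.{u}]
  have hinj := Module.Flat.iff_characterModule_injective.{u}.mp this
  let π := (LinearMap.range (evalDual (R := R) A)).mkQ
  have hπ : Function.Injective (dual π) :=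
    dual_injective_of_surjective _ (Submodule.mkQ_surjective _)
  have hex : Function.Exact (dual π) (dual (evalDual (R := R) A)) :=
    dual_exact (LinearMap.exact_map_mkQ_range _)
  refine ⟨fun X Y _ _ _ _ f hf g ↦ ?_⟩
  obtain ⟨h, hh⟩ := hinj.out f hf ((dual π).comp g)
  let h' := h - ((evalDual (R := R) (CharacterModule A)).comp (dual (evalDual A))).comp h
  have hmem (y : Y) : h' y ∈ LinearMap.range (dual π) := by
    refine (hex _).mp ?_
    change dual (evalDual A) (h y - evalDual (CharacterModule A) (dual (evalDual A) (h y))) = 0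
    rw [map_sub, sub_eq_zero]
    rfl
  refine ⟨(LinearEquiv.ofInjective (dual π) hπ).symm.toLinearMap.comp (h'.codRestrict _ hmem),
    fun x ↦ ?_⟩
  change (LinearEquiv.ofInjective (dual π) hπ).symm _ = _
  rw [LinearEquiv.symm_apply_eq]
  ext1
  change h (f x) - evalDual (CharacterModule A) (dual (evalDual A) (h (f x))) = dual π (g x)
  rw [hh, LinearMap.comp_apply, hex.apply_apply_eq_zero, map_zero, sub_zero]

end CharacterModule

end CharacterModuleLemmas

section ExtLemmas

variable {R : Type u} [CommRing R]

lemma subsingleton_ext_iff (M N : ModuleCat.{u} R) (n : ℕ) :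
    Subsingleton (((_root_.Ext R (ModuleCat.{u} R) (n + 1)).obj (Opposite.op M)).obj N) ↔
      Subsingleton (Abelian.Ext M N (n + 1)) := by
  let P := ProjectiveResolution.of M
  have h₁ : Subsingleton
      (((_root_.Ext R (ModuleCat.{u} R) (n + 1)).obj (Opposite.op M)).obj N) ↔
      ∀ f : P.complex.X (n + 1) ⟶ N, P.complex.d (n + 2) (n + 1) ≫ f = 0 →
        ∃ g : P.complex.X n ⟶ N, P.complex.d (n + 1) n ≫ g = f := by
    rw [← ModuleCat.isZero_iff_subsingleton, (P.isoExt (n + 1) N).isZero_iff,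
      ← HomologicalComplex.exactAt_iff_isZero_homology,
      HomologicalComplex.exactAt_iff' _ n (n + 1) (n + 2) (by simp) (by simp),
      ShortComplex.moduleCat_exact_iff]
    rfl
  rw [h₁]
  constructor
  · intro h
    refine ⟨fun x y ↦ ?_⟩
    suffices ∀ z : Abelian.Ext M N (n + 1), z = 0 from (this x).trans (this y).symm
    intro z
    obtain ⟨f, hf, rfl⟩ := P.extMk_surjective z (n + 2) rfl
    exact (P.extMk_eq_zero_iff f (n + 2) rfl hf n rfl).mpr (h f hf)
  · intro h f hf
    exact (P.extMk_eq_zero_iff f (n + 2) rfl hf n rfl).mp (Subsingleton.elim _ _)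

lemma extZero_iff (M N : ModuleCat.{u} R) :
    extZero R M N ↔ ∀ n, Subsingleton (Abelian.Ext M N (n + 1)) := by
  constructor
  · exact fun h n ↦ (subsingleton_ext_iff M N n).mp (h (n + 1) (by simp))
  · rintro h (_ | n) hn
    · simp at hn
    · exact (subsingleton_ext_iff M N n).mpr (h n)

lemma subsingleton_ext_of_retract (M : ModuleCat.{u} R) {X Y : ModuleCat.{u} R} (s : X ⟶ Y)
    (r : Y ⟶ X) (h : s ≫ r = 𝟙 X) (n : ℕ) [Subsingleton (Abelian.Ext M Y n)] :
    Subsingleton (Abelian.Ext M X n) := by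
  refine subsingleton_of_forall_eq 0 fun x ↦ ?_
  rw [← x.comp_mk₀_id, ← h, ← Abelian.Ext.mk₀_comp_mk₀,
    ← Abelian.Ext.comp_assoc_of_second_deg_zero,
    Subsingleton.elim (x.comp (Abelian.Ext.mk₀ s) (add_zero n)) 0, Abelian.Ext.zero_comp]

lemma subsingleton_ext_of_iso_left {M M' : ModuleCat.{u} R} (e : M ≅ M') (N : ModuleCat.{u} R)
    (n : ℕ) [Subsingleton (Abelian.Ext M' N n)] : Subsingleton (Abelian.Ext M N n) := by
  refine subsingleton_of_forall_eq 0 fun x ↦ ?_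
  rw [← x.mk₀_id_comp, ← e.hom_inv_id, ← Abelian.Ext.mk₀_comp_mk₀_assoc,
    Subsingleton.elim ((Abelian.Ext.mk₀ e.inv).comp x (zero_add n)) 0, Abelian.Ext.comp_zero]

/-- A short exact sequence and lifting of maps from `F` to its last term shift `Ext(F, -)`. -/
lemma subsingleton_ext_X₁ {S : ShortComplex (ModuleCat.{u} R)} (hS : S.ShortExact)
    (F : ModuleCat.{u} R) (h₂ : ∀ n, Subsingleton (Abelian.Ext F S.X₂ (n + 1)))
    (hlift : ∀ f : F ⟶ S.X₃, ∃ g : F ⟶ S.X₂, g ≫ S.g = f) (n : ℕ)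
    (h₃ : ∀ m, n = m + 1 → Subsingleton (Abelian.Ext F S.X₃ n)) :
    Subsingleton (Abelian.Ext F S.X₁ (n + 1)) := by
  refine subsingleton_of_forall_eq 0 fun x ↦ ?_
  have := h₂ n
  obtain ⟨y, rfl⟩ := Abelian.Ext.covariant_sequence_exact₁ F hS x (Subsingleton.elim _ _) rfl
  cases n with
  | zero =>
    obtain ⟨f, rfl⟩ := (Abelian.Ext.mk₀_bijective _ _).2 y
    obtain ⟨g, rfl⟩ := hlift f
    rw [← Abelian.Ext.mk₀_comp_mk₀, Abelian.Ext.comp_assoc_of_second_deg_zero, hS.comp_extClass,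
      Abelian.Ext.comp_zero]
  | succ n =>
    have := h₃ n rfl
    rw [Subsingleton.elim y 0, Abelian.Ext.zero_comp]

/-- A short exact sequence and extension of maps from its first term to `N` shift `Ext(-, N)`. -/
lemma subsingleton_ext_X₃ {S : ShortComplex (ModuleCat.{u} R)} (hS : S.ShortExact)
    (N : ModuleCat.{u} R) (h₂ : ∀ n, Subsingleton (Abelian.Ext S.X₂ N (n + 1)))
    (hext : ∀ f : S.X₁ ⟶ N, ∃ g : S.X₂ ⟶ N, S.f ≫ g = f) (n : ℕ)
    (h₁ : ∀ m, n = m + 1 → Subsingleton (Abelian.Ext S.X₁ N n)) :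
    Subsingleton (Abelian.Ext S.X₃ N (n + 1)) := by
  refine subsingleton_of_forall_eq 0 fun x ↦ ?_
  have := h₂ n
  obtain ⟨y, rfl⟩ := Abelian.Ext.contravariant_sequence_exact₃ hS N x (Subsingleton.elim _ _)
    (add_comm 1 n)
  cases n with
  | zero =>
    obtain ⟨f, rfl⟩ := (Abelian.Ext.mk₀_bijective _ _).2 y
    obtain ⟨g, rfl⟩ := hext f
    rw [← Abelian.Ext.mk₀_comp_mk₀, hS.extClass_comp_assoc]
  | succ n =>
    have := h₁ n rfl
    rw [Subsingleton.elim y 0, Abelian.Ext.comp_zero]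

open CharacterModule in
lemma shortExact_dual {A B D : Type u} [AddCommGroup A] [Module R A] [AddCommGroup B] [Module R B]
    [AddCommGroup D] [Module R D] {f : A →ₗ[R] B} {g : B →ₗ[R] D} (hf : Function.Injective f)
    (h : Function.Exact f g) (hg : Function.Surjective g) :
    (ModuleCat.shortComplexOfCompEqZero (dual g) (dual f)
      (dual_exact h).linearMap_comp_eq_zero).ShortExact :=
  ModuleCat.shortComplex_shortExact _ (dual_exact h) (dual_injective_of_surjective g hg)
    (dual_surjective_of_injective f hf)

open CharacterModule in
/-- Character modules are cotorsion. -/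
lemma subsingleton_ext_characterModule (F : ModuleCat.{u} R) [Module.Flat R F] (n : ℕ)
    (B : Type u) [AddCommGroup B] [Module R B] :
    Subsingleton (Abelian.Ext F (ModuleCat.of R (CharacterModule B)) (n + 1)) := by
  induction n using Nat.strong_induction_on generalizing B with
  | h n ih =>
  let p : (B →₀ R) →ₗ[R] B := Finsupp.linearCombination R id
  have hp : Function.Surjective p := Finsupp.linearCombination_id_surjective R B
  have hex := LinearMap.exact_subtype_ker_map p
  have hk := (LinearMap.ker p).injective_subtype
  have : Module.Injective R (CharacterModule (B →₀ R)) :=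
    Module.Flat.iff_characterModule_injective.mp inferInstance
  have : Injective (ModuleCat.of R (CharacterModule (B →₀ R))) :=
    Module.injective_object_of_injective_module R _
  refine subsingleton_ext_X₁ (shortExact_dual (A := LinearMap.ker p) hk hex hp) F
    (fun m ↦ subsingleton_of_forall_eq 0 Abelian.Ext.eq_zero_of_injective) ?_ n ?_
  · intro f
    have h₁ : Function.Injective ((LinearMap.ker p).subtype.lTensor F) :=
      Module.Flat.lTensor_preserves_injective_linearMap _ hk
    obtain ⟨c, hc⟩ := dual_surjective_of_injective _ h₁ (uncurry f.hom)
    refine ⟨ModuleCat.ofHom (curry c), ?_⟩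
    ext x : 2
    refine DFunLike.ext _ _ fun y ↦ ?_
    exact DFunLike.congr_fun hc (x ⊗ₜ y)
  · rintro m rfl
    exact ih m (by simp) _

end ExtLemmas

section Vanishing

variable {R : Type u} [CommRing R]

open CharacterModule

/-- Over a noetherian ring, a flat cotorsion module is a direct summand of its double character
module. -/
lemma exists_retraction_evalDual [IsNoetherianRing R] (F : ModuleCat.{u} R) [Module.Flat R F]
    (hF : IsCotorsion R F) :
    ∃ r : CharacterModule (CharacterModule F) →ₗ[R] F, r.comp (evalDual F) = LinearMap.id := by
  let π := (LinearMap.range (evalDual (R := R) F)).mkQ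
  have hex : Function.Exact (evalDual (R := R) F) π := LinearMap.exact_map_mkQ_range _
  have hS := ModuleCat.shortComplex_shortExact
    (ModuleCat.shortComplexOfCompEqZero (evalDual (R := R) F) π hex.linearMap_comp_eq_zero)
    hex evalDual_injective (Submodule.mkQ_surjective _)
  have : Subsingleton (Abelian.Ext (ModuleCat.of R (CharacterModule (CharacterModule F) ⧸
      LinearMap.range (evalDual (R := R) F))) F 1) :=
    (extZero_iff _ _).mp (hF (ModuleCat.of R _) flat_quotient_range_evalDual) 0
  obtain ⟨y, hy⟩ := Abelian.Ext.contravariant_sequence_exact₁ hS F (Abelian.Ext.mk₀ (𝟙 F))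
    rfl (Subsingleton.elim _ _)
  obtain ⟨r, rfl⟩ := (Abelian.Ext.mk₀_bijective _ _).2 y
  rw [Abelian.Ext.mk₀_comp_mk₀] at hy
  exact ⟨r.hom, congrArg ModuleCat.Hom.hom ((Abelian.Ext.mk₀_bijective _ _).1 hy)⟩

/-- Over a noetherian ring, a `C`-flat `C`-cotorsion module is a direct summand of the character
module of a `C`-injective module. -/
lemma IsCFlatCotorsion.exists_retract [IsNoetherianRing R] {C : ModuleCat.{u} R}
    [Module.Finite R C] {X : ModuleCat.{u} R} (hX : IsCFlatCotorsion R C X) :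
    ∃ J : ModuleCat.{u} R, IsCInjective R C J ∧
      ∃ (s : X ⟶ ModuleCat.of R (CharacterModule J)) (r : ModuleCat.of R (CharacterModule J) ⟶ X),
        s ≫ r = 𝟙 X := by
  obtain ⟨F, hF, hFc, ⟨e⟩⟩ := hX
  obtain ⟨r, hr⟩ := exists_retraction_evalDual F hFc
  have : Module.FinitePresentation R C := Module.finitePresentation_of_finite R C
  let t : (CharacterModule (CharacterModule F) ⊗[R] C) ≃ₗ[R]
      CharacterModule (C →ₗ[R] CharacterModule F) :=
    (TensorProduct.comm R _ _).trans (LinearEquiv.ofBijective _ tensorDualHom_bijective)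
  refine ⟨ModuleCat.of R (C →ₗ[R] CharacterModule F), ⟨ModuleCat.of R (CharacterModule F),
    Module.Flat.iff_characterModule_injective.mp hF, ⟨LinearEquiv.refl _ _⟩⟩,
    ModuleCat.ofHom (t.toLinearMap.comp (((evalDual F).rTensor C).comp e.toLinearMap)),
    ModuleCat.ofHom (e.symm.toLinearMap.comp ((r.rTensor C).comp t.symm.toLinearMap)), ?_⟩
  ext x
  have h := LinearMap.congr_fun (LinearMap.rTensor_comp C r (evalDual F)) (e x)
  rw [hr, LinearMap.rTensor_id] at h
  simpa using congrArg e.symm h.symm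

/-- The cokernels in nonnegative degrees of an exact complex which is flat in nonnegative degrees
and remains exact after tensoring with `J` are `Ext`-orthogonal to the character module of `J`. -/
lemma ZComplex.subsingleton_ext_coker (Z : ZComplex R) (hZ : Z.IsExact)
    (hflat : ∀ i : ℤ, 0 ≤ i → Module.Flat R (Z.X i)) {J : ModuleCat.{u} R} (hJ : Z.TensorExact J)
    (n : ℕ) (i : ℤ) (hi : 0 ≤ i) :
    Subsingleton (Abelian.Ext (ModuleCat.of R (Z.X i ⧸ LinearMap.range (Z.d i)))
      (ModuleCat.of R (CharacterModule J)) (n + 1)) := by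
  induction n using Nat.strong_induction_on generalizing i with
  | h n ih =>
  have := hflat i hi
  let q := (LinearMap.range (Z.d (i + 1))).mkQ
  let ι : (Z.X (i + 1) ⧸ LinearMap.range (Z.d (i + 1))) →ₗ[R] Z.X i :=
    (LinearMap.range (Z.d (i + 1))).liftQ (Z.d i) ((LinearMap.exact_iff.mp (hZ i)).ge)
  have hιq : ι.comp q = Z.d i := Submodule.liftQ_mkQ _ _ _
  have hι : Function.Injective ι := LinearMap.ker_eq_bot.mp
    (Submodule.ker_liftQ_eq_bot _ _ _ (LinearMap.exact_iff.mp (hZ i)).le)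
  have hex : Function.Exact ι (LinearMap.range (Z.d i)).mkQ := by
    rw [LinearMap.exact_iff, Submodule.ker_mkQ, Submodule.range_liftQ]
  have hq : Function.Surjective (q.rTensor J) :=
    LinearMap.rTensor_surjective _ (Submodule.mkQ_surjective _)
  have hιJ : Function.Injective (ι.rTensor J) := by
    refine (injective_iff_map_eq_zero _).2 fun x hx ↦ ?_
    obtain ⟨y, rfl⟩ := hq x
    rw [← LinearMap.comp_apply, ← LinearMap.rTensor_comp, hιq] at hx
    obtain ⟨z, rfl⟩ := (hJ i y).mp hx
    exact (rTensor_exact J (LinearMap.exact_map_mkQ_range (Z.d (i + 1)))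
      (Submodule.mkQ_surjective _)).apply_apply_eq_zero z
  refine subsingleton_ext_X₃ (ModuleCat.shortComplex_shortExact
    (ModuleCat.shortComplexOfCompEqZero ι _ hex.linearMap_comp_eq_zero) hex hι
    (Submodule.mkQ_surjective _)) _ (fun m ↦ subsingleton_ext_characterModule _ m J) ?_ n ?_
  · intro f
    obtain ⟨g, hg⟩ := rTensor_injective_iff_lcomp_surjective.mp hιJ f.hom
    exact ⟨ModuleCat.ofHom g, ModuleCat.hom_ext hg⟩
  · rintro m rfl
    exact ih m (by simp) (i + 1) (by positivity)

lemma IsGCFlat.subsingleton_ext_characterModule {C M J : ModuleCat.{u} R} (hM : IsGCFlat R C M)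
    (hJ : IsCInjective R C J) (n : ℕ) :
    Subsingleton (Abelian.Ext M (ModuleCat.of R (CharacterModule J)) (n + 1)) := by
  obtain ⟨Z, hZ, hflat, -, hT, ⟨e⟩⟩ := hM
  have := Z.subsingleton_ext_coker hZ hflat (hT J hJ) n 0 le_rfl
  exact subsingleton_ext_of_iso_left (LinearEquiv.toModuleIso e) _ _

/-- `Ext`-vanishing on a class of modules passes to modules with finite resolutions by that
class. -/
lemma HasResOfLength.subsingleton_ext {M : ModuleCat.{u} R} {𝒳 : ModuleCat.{u} R → Prop}
    (h𝒳 : ∀ X, 𝒳 X → ∀ k, Subsingleton (Abelian.Ext M X (k + 1))) {n : ℕ} {N : ModuleCat.{u} R}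
    (hN : HasResOfLength R 𝒳 n N) (k : ℕ) : Subsingleton (Abelian.Ext M N (k + 1)) := by
  induction n generalizing N k with
  | zero =>
    obtain ⟨P, d, ε, hε, hdε, -, hP, h0⟩ := hN
    have := h0 1 one_pos
    have hinj : Function.Injective ε := (injective_iff_map_eq_zero _).2 fun x hx ↦ by
      obtain ⟨y, rfl⟩ := (hdε x).mp hx
      rw [Subsingleton.elim y 0, map_zero]
    let e := (LinearEquiv.ofBijective ε ⟨hinj, hε⟩).toModuleIso
    have := h𝒳 _ (hP 0 le_rfl) k
    exact subsingleton_ext_of_retract M e.inv e.hom e.inv_hom_id _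
  | succ n ih =>
    obtain ⟨P, d, ε, hε, hdε, hd, hP, h0⟩ := hN
    have hK : HasResOfLength R 𝒳 n (ModuleCat.of R (LinearMap.ker ε)) := by
      refine ⟨fun i ↦ P (i + 1), fun i ↦ d (i + 1),
        (d 0).codRestrict (LinearMap.ker ε) fun x ↦ hdε.apply_apply_eq_zero x, ?_, ?_,
        fun i ↦ hd (i + 1), fun i hi ↦ hP _ (by lia), fun i hi ↦ h0 _ (by lia)⟩
      · rintro ⟨x, hx⟩
        obtain ⟨y, rfl⟩ := (hdε x).mp hx
        exact ⟨y, rfl⟩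
      · intro x
        rw [← hd 0 x, Subtype.ext_iff]
        rfl
    have := ih hK (k + 1)
    have := h𝒳 _ (hP 0 (by simp)) k
    refine subsingleton_of_forall_eq 0 fun x ↦ ?_
    obtain ⟨y, rfl⟩ := Abelian.Ext.covariant_sequence_exact₃ M
      (LinearMap.shortExact_shortComplexKer hε) x rfl (Subsingleton.elim _ _)
    rw [Subsingleton.elim y 0, Abelian.Ext.zero_comp]

end Vanishing

/-- If `M` is `G_C`-flat and `N` has finite `C`-flat `C`-cotorsion
projective dimension, then `Ext_R^i(M,N) = 0` for all `i ≥ 1`. -/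
theorem stmt3 (R : Type u) [CommRing R] [IsNoetherianRing R]
    (C : ModuleCat.{u} R) (hC : IsSemidualizing R C) (M N : ModuleCat.{u} R)
    (hM : IsGCFlat R C M)
    (hN : ∃ n, HasResOfLength R (IsCFlatCotorsion R C) n N) :
    extZero R M N := by
  have := hC.1
  obtain ⟨n, hN⟩ := hN
  refine (extZero_iff M N).mpr (hN.subsingleton_ext fun X hX k ↦ ?_)
  obtain ⟨J, hJ, s, r, hsr⟩ := hX.exists_retract
  have := hM.subsingleton_ext_characterModule hJ k
  exact subsingleton_ext_of_retract M s r hsr _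
end

section
/- Let R be a commutative noetherian ring and C a semidualizing R-module. For every G_C-flat R-module M there exists a short exact sequence 0 → M → W → M' → 0 of R-modules in which W is C-flat C-cotorsion and M' is G_C-flat. -/
open CategoryTheory TensorProduct

universe u

/-! ### The evaluation map `A ⊗ Hom(X, I) → Hom(Hom(A, X), I)` -/

namespace GCFlat

section HomEval

variable {R : Type u} [CommRing R]
  {A B X I : Type u} [AddCommGroup A] [Module R A] [AddCommGroup B] [Module R B]
  [AddCommGroup X] [Module R X] [AddCommGroup I] [Module R I]

variable (R A X I) in
/-- The natural map `A ⊗ Hom(X, I) → Hom(Hom(A, X), I)`. -/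
def homEval : A ⊗[R] (X →ₗ[R] I) →ₗ[R] ((A →ₗ[R] X) →ₗ[R] I) :=
  TensorProduct.lift (LinearMap.mk₂ R (fun a h ↦ h ∘ₗ LinearMap.applyₗ a)
    (fun _ _ _ ↦ by ext; simp) (fun _ _ _ ↦ by ext; simp)
    (fun _ _ _ ↦ by ext; simp) (fun _ _ _ ↦ by ext; simp))

@[simp]
lemma homEval_tmul (a : A) (h : X →ₗ[R] I) (f : A →ₗ[R] X) :
    homEval R A X I (a ⊗ₜ h) f = h (f a) := rfl

lemma homEval_naturality (φ : A →ₗ[R] B) :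
    (φ.lcomp R X).lcomp R I ∘ₗ homEval R A X I =
      homEval R B X I ∘ₗ φ.rTensor (X →ₗ[R] I) := by
  ext a h f
  simp

lemma bijective_homEval_pi (n : ℕ) : Function.Bijective (homEval R (Fin n → R) X I) := by
  let g : (((Fin n → R) →ₗ[R] X) →ₗ[R] I) → (Fin n → R) ⊗[R] (X →ₗ[R] I) := fun Φ ↦
    ∑ i, Pi.single i 1 ⊗ₜ (Φ ∘ₗ LinearMap.lcomp R X (LinearMap.proj i) ∘ₗ
      (LinearMap.ringLmapEquivSelf R R X).symm.toLinearMap)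
  refine Function.bijective_iff_has_inverse.mpr ⟨g, fun x ↦ ?_, fun Φ ↦ ?_⟩
  · induction x using TensorProduct.induction_on with
    | zero => simp [g]
    | add x y hx hy =>
      simp only [g, map_add, LinearMap.add_comp, TensorProduct.tmul_add,
        Finset.sum_add_distrib] at hx hy ⊢
      rw [hx, hy]
    | tmul a h =>
      have (i : Fin n) : homEval R (Fin n → R) X I (a ⊗ₜ h) ∘ₗ LinearMap.lcomp R X
          (LinearMap.proj i) ∘ₗ (LinearMap.ringLmapEquivSelf R R X).symm.toLinearMap = a i • h := by
        ext x
        simp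
      simp only [g, this, ← TensorProduct.smul_tmul, ← TensorProduct.sum_tmul]
      congr 1
      ext j
      simp [Pi.single_apply]
  · refine LinearMap.ext fun f ↦ ?_
    simp only [g, map_sum, LinearMap.sum_apply, homEval_tmul, LinearMap.comp_apply]
    rw [← map_sum]
    congr 1
    ext i
    simp

lemma exact_lcomp_of_exact_of_surjective {A B D : Type u} [AddCommGroup A] [Module R A]
    [AddCommGroup B] [Module R B] [AddCommGroup D] [Module R D]
    {f : A →ₗ[R] B} {g : B →ₗ[R] D} (h : Function.Exact f g) (hg : Function.Surjective g)
    (X : Type u) [AddCommGroup X] [Module R X] :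
    Function.Exact (g.lcomp R X) (f.lcomp R X) := by
  intro φ
  constructor
  · intro hφ
    have hle : LinearMap.ker g ≤ LinearMap.ker φ := by
      intro b hb
      obtain ⟨a, rfl⟩ := (h b).1 hb
      exact DFunLike.congr_fun hφ a
    refine ⟨(LinearMap.ker g).liftQ φ hle ∘ₗ (g.quotKerEquivOfSurjective hg).symm, ?_⟩
    ext b
    have : (g.quotKerEquivOfSurjective hg).symm (g b) = (LinearMap.ker g).mkQ b := by
      rw [LinearEquiv.symm_apply_eq]; rfl
    simp [this]
  · rintro ⟨ψ, rfl⟩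
    ext a
    simp [h.apply_apply_eq_zero]

/-- `Hom(-, I)` is exact for injective `I`. -/
lemma exact_lcomp_of_injective {A B D : Type u} [AddCommGroup A] [Module R A]
    [AddCommGroup B] [Module R B] [AddCommGroup D] [Module R D]
    {f : A →ₗ[R] B} {g : B →ₗ[R] D} (h : Function.Exact f g)
    (hI : Module.Injective R I) :
    Function.Exact (g.lcomp R I) (f.lcomp R I) := by
  intro φ
  constructor
  · intro hφ
    have hle : LinearMap.ker g ≤ LinearMap.ker φ := by
      intro b hb
      obtain ⟨a, rfl⟩ := (h b).1 hb
      exact DFunLike.congr_fun hφ a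
    obtain ⟨ψ, hψ⟩ := hI.out ((LinearMap.ker g).liftQ g le_rfl)
      (LinearMap.ker_eq_bot.mp (Submodule.ker_liftQ_eq_bot' _ g rfl)) ((LinearMap.ker g).liftQ φ hle)
    exact ⟨ψ, LinearMap.ext fun b ↦ hψ ((LinearMap.ker g).mkQ b)⟩
  · rintro ⟨ψ, rfl⟩
    ext a
    simp [h.apply_apply_eq_zero]

lemma surjective_lcomp_of_injective {f : A →ₗ[R] B} (hf : Function.Injective f)
    (hI : Module.Injective R I) : Function.Surjective (f.lcomp R I) := by
  intro φ
  obtain ⟨ψ, hψ⟩ := hI.out f hf φ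
  exact ⟨ψ, LinearMap.ext hψ⟩

lemma bijective_homEval [IsNoetherianRing R] [Module.Finite R A] (hI : Module.Injective R I) :
    Function.Bijective (homEval R A X I) := by
  obtain ⟨n, g, hg⟩ := Module.Finite.exists_fin' R A
  obtain ⟨m, p, hp⟩ := Module.Finite.exists_fin' R (LinearMap.ker g)
  let f : (Fin m → R) →ₗ[R] (Fin n → R) := (LinearMap.ker g).subtype ∘ₗ p
  have hfg : Function.Exact f g := by
    intro x
    constructor
    · intro hx
      obtain ⟨y, hy⟩ := hp ⟨x, hx⟩
      exact ⟨y, by simp [f, hy]⟩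
    · rintro ⟨y, rfl⟩
      exact (p y).2
  have hinj : Function.Injective (g.lcomp R X) := fun φ ψ h ↦ by
    ext a
    obtain ⟨b, rfl⟩ := hg a
    exact DFunLike.congr_fun h b
  exact LinearMap.bijective_of_surjective_of_bijective_of_right_exact
    (f.rTensor (X →ₗ[R] I)) (g.rTensor (X →ₗ[R] I))
    ((f.lcomp R X).lcomp R I) ((g.lcomp R X).lcomp R I)
    (homEval R _ X I) (homEval R _ X I) (homEval R A X I)
    (homEval_naturality f) (homEval_naturality g)
    (rTensor_exact _ hfg hg)
    (exact_lcomp_of_injective (exact_lcomp_of_exact_of_surjective hfg hg X) hI)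
    (bijective_homEval_pi m).2 (bijective_homEval_pi n)
    (LinearMap.rTensor_surjective _ hg) (surjective_lcomp_of_injective hinj hI)

/-- If `Hom(B, X) → Hom(A, X)` is surjective, then `A ⊗ Hom(X, I) → B ⊗ Hom(X, I)` is injective
for every injective module `I`. -/
lemma injective_rTensor_hom_of_surjective_lcomp [IsNoetherianRing R] [Module.Finite R A]
    (hI : Module.Injective R I) (f : A →ₗ[R] B) (hf : Function.Surjective (f.lcomp R X)) :
    Function.Injective (f.rTensor (X →ₗ[R] I)) := by
  have hinj : Function.Injective ((f.lcomp R X).lcomp R I) := fun φ ψ h ↦ by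
    refine LinearMap.ext fun a ↦ ?_
    obtain ⟨b, rfl⟩ := hf a
    exact DFunLike.congr_fun h b
  have h := hinj.comp (bijective_homEval (A := A) (X := X) hI).1
  rw [← LinearMap.coe_comp, homEval_naturality, LinearMap.coe_comp] at h
  exact h.of_comp

end HomEval

/-! ### Duality into the character module of the ring -/

section Duality

variable {R : Type u} [CommRing R]

lemma injective_characterModule_self : Module.Injective R (CharacterModule R) :=
  Module.Flat.iff_characterModule_injective.mp inferInstance

variable (R) in
/-- The dual of a module with respect to the injective cogenerator `CharacterModule R`. -/
abbrev CharDual (X : Type u) [AddCommGroup X] [Module R X] : Type u := X →ₗ[R] CharacterModule R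

variable (R) in
/-- The canonical map from a module to its double dual. -/
abbrev toBidual (X : Type u) [AddCommGroup X] [Module R X] : X →ₗ[R] CharDual R (CharDual R X) :=
  LinearMap.applyₗ

variable {X Y F C : Type u} [AddCommGroup X] [Module R X] [AddCommGroup Y] [Module R Y]
  [AddCommGroup F] [Module R F] [AddCommGroup C] [Module R C]

/-- The double dual of a linear map. -/
abbrev bidualMap (f : X →ₗ[R] Y) : CharDual R (CharDual R X) →ₗ[R] CharDual R (CharDual R Y) :=
  (f.lcomp R (CharacterModule R)).lcomp R (CharacterModule R)

lemma bidualMap_comp_toBidual (f : X →ₗ[R] Y) :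
    bidualMap f ∘ₗ toBidual R X = toBidual R Y ∘ₗ f := by
  ext; rfl

lemma toBidual_injective : Function.Injective (toBidual R X) := by
  refine (injective_iff_map_eq_zero _).mpr fun x hx ↦ ?_
  refine CharacterModule.eq_zero_of_character_apply fun c ↦ ?_
  have := DFunLike.congr_fun hx
    (CharacterModule.homEquiv.symm (CharacterModule.dual (TensorProduct.rid R X).toLinearMap c))
  have h : c ((1 : R) • x) = 0 := DFunLike.congr_fun this (1 : R)
  rwa [one_smul] at h

variable (R F C) in
/-- The natural map from `F'' ⊗ C` to the double dual of `F ⊗ C`. -/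
def bidualTensor : CharDual R (CharDual R F) ⊗[R] C →ₗ[R] CharDual R (CharDual R (F ⊗[R] C)) :=
  LinearMap.lcomp R (CharacterModule R)
    (TensorProduct.lcurry (RingHom.id R) C F (CharacterModule R) ∘ₗ
      LinearMap.lcomp R (CharacterModule R) (TensorProduct.comm R C F).toLinearMap) ∘ₗ
    homEval R C (CharDual R F) (CharacterModule R) ∘ₗ
    (TensorProduct.comm R (CharDual R (CharDual R F)) C).toLinearMap

lemma bidualTensor_comp_rTensor_toBidual :
    bidualTensor R F C ∘ₗ (toBidual R F).rTensor C = toBidual R (F ⊗[R] C) := by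
  ext f c h
  rfl

lemma bijective_bidualTensor [IsNoetherianRing R] [Module.Finite R C] :
    Function.Bijective (bidualTensor R F C) := by
  have h1 := bijective_homEval (A := C) (X := CharDual R F)
    (injective_characterModule_self (R := R))
  let e : (CharDual R (F ⊗[R] C)) ≃ₗ[R] (C →ₗ[R] CharDual R F) :=
    LinearEquiv.congrLeft (CharacterModule R) R (TensorProduct.comm R F C) ≪≫ₗ
      (TensorProduct.lift.equiv (RingHom.id R) C F (CharacterModule R)).symm
  have he : (TensorProduct.lcurry (RingHom.id R) C F (CharacterModule R) ∘ₗ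
      LinearMap.lcomp R (CharacterModule R) (TensorProduct.comm R C F).toLinearMap) =
        e.toLinearMap := by
    ext; rfl
  have h2 : Function.Bijective (LinearMap.lcomp R (CharacterModule R) e.toLinearMap) :=
    (LinearEquiv.congrLeft (CharacterModule R) R e.symm).bijective
  rw [bidualTensor, he]
  exact h2.comp (h1.comp (TensorProduct.comm R (CharDual R (CharDual R F)) C).bijective)

/-- The inclusion into the double dual is a pure monomorphism. -/
lemma injective_rTensor_toBidual (J : Type u) [AddCommGroup J] [Module R J] :
    Function.Injective ((toBidual R X).rTensor J) := by
  have h : Function.Injective (toBidual R (X ⊗[R] J)) := toBidual_injective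
  rw [← bidualTensor_comp_rTensor_toBidual, LinearMap.coe_comp] at h
  exact h.of_comp

lemma injective_charDual [Module.Flat R F] : Module.Injective R (CharDual R F) := by
  have h : Module.Injective R (CharacterModule (F ⊗[R] R)) :=
    Module.Flat.iff_characterModule_injective.mp inferInstance
  exact (Module.Baer.of_equiv CharacterModule.homEquiv.symm
    (Module.Baer.iff_injective.mpr h)).injective

instance flat_bidual [IsNoetherianRing R] [Module.Flat R F] :
    Module.Flat R (CharDual R (CharDual R F)) := by
  rw [Module.Flat.iff_rTensor_injective]
  intro I _
  exact injective_rTensor_hom_of_surjective_lcomp injective_characterModule_self _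
    (surjective_lcomp_of_injective I.subtype_injective injective_charDual)

/-- The cokernel of a pure monomorphism into a flat module is flat. -/
lemma flat_quotient_range_of_pure [Module.Flat R Y] (f : X →ₗ[R] Y)
    (hf : ∀ (J : Type u) [AddCommGroup J] [Module R J], Function.Injective (f.rTensor J)) :
    Module.Flat R (Y ⧸ LinearMap.range f) := by
  rw [Module.Flat.iff_lTensor_preserves_injective_linearMap]
  intro A B _ _ _ _ i hi
  have hex (J : Type u) [AddCommGroup J] [Module R J] :
      Function.Exact (f.rTensor J) ((LinearMap.range f).mkQ.rTensor J) :=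
    rTensor_exact J (LinearMap.exact_map_mkQ_range f) (Submodule.mkQ_surjective _)
  let q := (LinearMap.range i).mkQ
  have hq : Function.Exact i q := LinearMap.exact_map_mkQ_range i
  refine (injective_iff_map_eq_zero _).mpr fun x hx ↦ ?_
  obtain ⟨y, rfl⟩ := LinearMap.rTensor_surjective A (Submodule.mkQ_surjective _) x
  rw [← LinearMap.comp_apply, LinearMap.lTensor_comp_rTensor, ← LinearMap.rTensor_comp_lTensor,
    LinearMap.comp_apply] at hx
  obtain ⟨b, hb⟩ := (hex B _).mp hx
  have hqb : q.lTensor X b = 0 := by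
    apply hf (B ⧸ LinearMap.range i)
    rw [map_zero, ← LinearMap.comp_apply, LinearMap.rTensor_comp_lTensor,
      ← LinearMap.lTensor_comp_rTensor, LinearMap.comp_apply, hb, ← LinearMap.lTensor_comp_apply,
      hq.linearMap_comp_eq_zero, LinearMap.lTensor_zero, LinearMap.zero_apply]
  obtain ⟨a, rfl⟩ := (lTensor_exact X hq (Submodule.mkQ_surjective _) b).mp hqb
  have hya : f.rTensor A a = y := by
    apply Module.Flat.lTensor_preserves_injective_linearMap (M := Y) i hi
    rw [← hb, ← LinearMap.comp_apply, ← LinearMap.comp_apply, LinearMap.lTensor_comp_rTensor,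
      LinearMap.rTensor_comp_lTensor]
  rw [← hya]
  exact (hex A).apply_apply_eq_zero a

end Duality

section CFlat

variable {R : Type u} [CommRing R] {C : ModuleCat.{u} R}

lemma exists_bidual_equiv [IsNoetherianRing R] [Module.Finite R C] {Y F : Type u}
    [AddCommGroup Y] [Module R Y] [AddCommGroup F] [Module R F] (e : Y ≃ₗ[R] F ⊗[R] C) :
    ∃ κ : CharDual R (CharDual R Y) ≃ₗ[R] CharDual R (CharDual R F) ⊗[R] C,
      ∀ y, κ (toBidual R Y y) = (toBidual R F).rTensor C (e y) := by
  let θ := LinearEquiv.ofBijective (bidualTensor R F C) bijective_bidualTensor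
  let ε : CharDual R (CharDual R Y) ≃ₗ[R] CharDual R (CharDual R (F ⊗[R] C)) :=
    LinearEquiv.congrLeft _ R (LinearEquiv.congrLeft _ R e)
  refine ⟨ε ≪≫ₗ θ.symm, fun y ↦ ?_⟩
  rw [LinearEquiv.trans_apply, LinearEquiv.symm_apply_eq]
  have h := LinearMap.congr_fun (bidualTensor_comp_rTensor_toBidual (R := R) (F := F) (C := C)) (e y)
  refine Eq.trans ?_ h.symm
  ext φ r
  simp [ε, LinearEquiv.congrLeft]

lemma flat_prod {F G : Type u} [AddCommGroup F] [Module R F] [AddCommGroup G] [Module R G]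
    [Module.Flat R F] [Module.Flat R G] : Module.Flat R (F × G) := by
  rw [Module.Flat.iff_lTensor_preserves_injective_linearMap]
  intro A B _ _ _ _ i hi
  refine (injective_iff_map_eq_zero _).mpr fun x hx ↦ ?_
  have hfst : (LinearMap.fst R F G).rTensor A x = 0 := by
    apply Module.Flat.lTensor_preserves_injective_linearMap (M := F) i hi
    rw [← LinearMap.comp_apply, LinearMap.lTensor_comp_rTensor, ← LinearMap.rTensor_comp_lTensor,
      LinearMap.comp_apply, hx, map_zero, map_zero]
  have hsnd : (LinearMap.snd R F G).rTensor A x = 0 := by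
    apply Module.Flat.lTensor_preserves_injective_linearMap (M := G) i hi
    rw [← LinearMap.comp_apply, LinearMap.lTensor_comp_rTensor, ← LinearMap.rTensor_comp_lTensor,
      LinearMap.comp_apply, hx, map_zero, map_zero]
  have hid : LinearMap.inl R F G ∘ₗ LinearMap.fst R F G +
      LinearMap.inr R F G ∘ₗ LinearMap.snd R F G = LinearMap.id := by
    ext <;> simp
  have := LinearMap.rTensor_id_apply A (F × G) x
  rw [← hid, LinearMap.rTensor_add, LinearMap.add_apply, LinearMap.rTensor_comp_apply,
    LinearMap.rTensor_comp_apply, hfst, hsnd, map_zero, map_zero, add_zero] at this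
  exact this.symm

lemma isCFlat_prod {X Y : Type u} [AddCommGroup X] [Module R X] [AddCommGroup Y] [Module R Y]
    (hX : IsCFlat R C (ModuleCat.of R X)) (hY : IsCFlat R C (ModuleCat.of R Y)) :
    IsCFlat R C (ModuleCat.of R (X × Y)) := by
  obtain ⟨F, hF, ⟨e⟩⟩ := hX
  obtain ⟨G, hG, ⟨e'⟩⟩ := hY
  exact ⟨ModuleCat.of R (F × G), flat_prod (F := F) (G := G),
    ⟨LinearEquiv.prodCongr e e' ≪≫ₗ (TensorProduct.prodLeft R R F G C).symm⟩⟩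

lemma isCFlat_bidual [IsNoetherianRing R] [Module.Finite R C] {Y : Type u} [AddCommGroup Y]
    [Module R Y] (hY : IsCFlat R C (ModuleCat.of R Y)) :
    IsCFlat R C (ModuleCat.of R (CharDual R (CharDual R Y))) := by
  obtain ⟨F, hF, ⟨e⟩⟩ := hY
  obtain ⟨κ, -⟩ := exists_bidual_equiv e
  exact ⟨ModuleCat.of R (CharDual R (CharDual R F)), flat_bidual (F := F), ⟨κ⟩⟩

lemma isCFlat_bidual_quotient [IsNoetherianRing R] [Module.Finite R C] {Y : Type u}
    [AddCommGroup Y] [Module R Y] (hY : IsCFlat R C (ModuleCat.of R Y)) :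
    IsCFlat R C (ModuleCat.of R
      (CharDual R (CharDual R Y) ⧸ LinearMap.range (toBidual R Y))) := by
  obtain ⟨F, hF, ⟨e⟩⟩ := hY
  obtain ⟨κ, hκ⟩ := exists_bidual_equiv e
  refine ⟨ModuleCat.of R (CharDual R (CharDual R F) ⧸ LinearMap.range (toBidual R F)),
    flat_quotient_range_of_pure (toBidual R F) fun J _ _ ↦ injective_rTensor_toBidual J, ⟨?_⟩⟩
  have hex : Function.Exact ((toBidual R F).rTensor C)
      ((LinearMap.range (toBidual R F)).mkQ.rTensor C) :=
    rTensor_exact C (LinearMap.exact_map_mkQ_range _) (Submodule.mkQ_surjective _)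
  refine Submodule.Quotient.equiv _ (LinearMap.range ((toBidual R F).rTensor C)) κ ?_ ≪≫ₗ
    hex.linearEquivOfSurjective (LinearMap.rTensor_surjective C (Submodule.mkQ_surjective _))
  have hcomp : κ.toLinearMap ∘ₗ toBidual R Y = (toBidual R F).rTensor C ∘ₗ e.toLinearMap :=
    LinearMap.ext hκ
  rw [← LinearMap.range_comp]
  erw [hcomp]
  rw [LinearMap.range_comp_of_range_eq_top _ e.range]

end CFlat

section ExtVanishing

variable {R : Type u} [CommRing R]

/-- `Ext^i(N, V) = 0` for all `i ≥ 1`, in terms of the `Ext`-groups of the derived category. -/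
def ExtVanishes (N V : ModuleCat.{u} R) : Prop :=
  ∀ i : ℕ, 1 ≤ i → Subsingleton (Abelian.Ext N V i)

lemma extZero_iff_extVanishes (N V : ModuleCat.{u} R) : extZero R N V ↔ ExtVanishes N V := by
  refine forall₂_congr fun i hi ↦ ?_
  obtain ⟨p, rfl⟩ : ∃ p, i = p + 1 := ⟨i - 1, by lia⟩
  let P : ProjectiveResolution N := projectiveResolution N
  rw [← ModuleCat.isZero_iff_subsingleton, (P.isoExt (R := R) (p + 1) V).isZero_iff,
    ← HomologicalComplex.exactAt_iff_isZero_homology,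
    HomologicalComplex.exactAt_iff' _ p (p + 1) (p + 2) (by simp) (by simp),
    ShortComplex.moduleCat_exact_iff]
  constructor
  · intro h
    refine ⟨fun a b ↦ ?_⟩
    have key : ∀ α : Abelian.Ext N V (p + 1), α = 0 := by
      intro α
      obtain ⟨f, hf, rfl⟩ := P.extMk_surjective α (p + 2) rfl
      rw [P.extMk_eq_zero_iff f _ rfl hf p rfl]
      exact h f hf
    rw [key a, key b]
  · intro h f hf
    exact (P.extMk_eq_zero_iff f (p + 2) rfl hf p rfl).mp (Subsingleton.elim _ _)

end ExtVanishing

section ShortExact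

variable {R : Type u} [CommRing R]

/-- `0 → A → B → N → 0` is a short exact sequence. -/
def IsShortExact {A B N : Type*} [AddCommGroup A] [Module R A] [AddCommGroup B] [Module R B]
    [AddCommGroup N] [Module R N] (f : A →ₗ[R] B) (g : B →ₗ[R] N) : Prop :=
  Function.Injective f ∧ Function.Exact f g ∧ Function.Surjective g

variable {A B N V : ModuleCat.{u} R} {f : A →ₗ[R] B} {g : B →ₗ[R] N}

lemma IsShortExact.shortExact (h : IsShortExact f g) :
    (ShortComplex.mk (ModuleCat.ofHom f) (ModuleCat.ofHom g)
      (ModuleCat.hom_ext h.2.1.linearMap_comp_eq_zero)).ShortExact where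
  exact := (ShortComplex.ShortExact.moduleCat_exact_iff_function_exact _).mpr h.2.1
  mono_f := (ModuleCat.mono_iff_injective _).mpr h.1
  epi_g := (ModuleCat.epi_iff_surjective _).mpr h.2.2

lemma IsShortExact.surjective_lcomp (h : IsShortExact f g) (hN : ExtVanishes N V) :
    Function.Surjective (f.lcomp R V) := by
  intro a
  have := hN 1 le_rfl
  obtain ⟨x, hx⟩ := Abelian.Ext.contravariant_sequence_exact₁ h.shortExact V
    (Abelian.Ext.mk₀ (ModuleCat.ofHom a)) (n₁ := 1) rfl (Subsingleton.elim _ _)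
  obtain ⟨b, rfl⟩ := Abelian.Ext.addEquiv₀.symm.surjective x
  refine ⟨b.hom, ?_⟩
  erw [Abelian.Ext.mk₀_comp_mk₀] at hx
  exact congrArg ModuleCat.Hom.hom (Abelian.Ext.addEquiv₀.symm.injective hx)

lemma IsShortExact.extVanishes_left (h : IsShortExact f g) (hB : ExtVanishes B V)
    (hN : ExtVanishes N V) : ExtVanishes A V := by
  intro i hi
  have h0 : ∀ α : Abelian.Ext A V i, α = 0 := by
    intro α
    have := hN (1 + i) (by lia)
    have := hB i hi
    obtain ⟨x, rfl⟩ := Abelian.Ext.contravariant_sequence_exact₁ h.shortExact V α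
      rfl (Subsingleton.elim _ _)
    obtain rfl : x = 0 := Subsingleton.elim _ _
    simp
  exact ⟨fun a b ↦ by rw [h0 a, h0 b]⟩

lemma extClass_comp_mk₀_comp {S : ShortComplex (ModuleCat.{u} R)} (hS : S.ShortExact)
    (b : S.X₂ ⟶ V) : hS.extClass.comp (Abelian.Ext.mk₀ (S.f ≫ b)) (Nat.add_zero 1) = 0 := by
  rw [← Abelian.Ext.mk₀_comp_mk₀, hS.extClass_comp_assoc]

lemma extVanishes_of_family (Q : ModuleCat.{u} R → Prop)
    (hQ : ∀ N, Q N → ∃ (A B : ModuleCat.{u} R) (f : A →ₗ[R] B) (g : B →ₗ[R] N),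
      IsShortExact f g ∧ ExtVanishes B V ∧ Q A ∧ Function.Surjective (f.lcomp R V))
    (hN : Q N) : ExtVanishes N V := by
  intro i hi
  obtain ⟨n, rfl⟩ : ∃ n, i = 1 + n := ⟨i - 1, by lia⟩
  clear hi
  have key : ∀ n : ℕ, ∀ N, Q N → ∀ α : Abelian.Ext N V (1 + n), α = 0 := by
    intro n
    induction n with
    | zero =>
      intro N hN α
      obtain ⟨A, B, f, g, h, hB, -, hs⟩ := hQ N hN
      obtain ⟨x, rfl⟩ := Abelian.Ext.contravariant_sequence_exact₃ h.shortExact V α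
        (Subsingleton.elim (h := hB 1 le_rfl) _ _) (n₀ := 0) rfl
      obtain ⟨a, rfl⟩ := Abelian.Ext.addEquiv₀.symm.surjective x
      obtain ⟨b, hb⟩ := hs a.hom
      have hab : a = ModuleCat.ofHom f ≫ ModuleCat.ofHom b := ModuleCat.hom_ext hb.symm
      rw [hab]
      exact extClass_comp_mk₀_comp h.shortExact (ModuleCat.ofHom b)
    | succ n ih =>
      intro N hN α
      obtain ⟨A, B, f, g, h, hB, hA, -⟩ := hQ N hN
      obtain ⟨x, rfl⟩ := Abelian.Ext.contravariant_sequence_exact₃ h.shortExact V α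
        (Subsingleton.elim (h := hB _ (by lia)) _ _) (n₀ := 1 + n) (by lia)
      erw [ih A hA x]
      simp
  exact ⟨fun a b ↦ by rw [key n N hN a, key n N hN b]⟩

lemma extVanishes_of_projective [Module.Projective R B] : ExtVanishes B V := by
  intro i hi
  obtain ⟨n, rfl⟩ : ∃ n, i = n + 1 := ⟨i - 1, by lia⟩
  have : Projective B := (IsProjective.iff_projective _).mp inferInstance
  exact ⟨fun a b ↦ by rw [Abelian.Ext.eq_zero_of_projective a, Abelian.Ext.eq_zero_of_projective b]⟩

/-- The free module on the elements of `N`. -/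
noncomputable def freeCover (N : ModuleCat.{u} R) : ModuleCat.{u} R :=
  ModuleCat.of R (N →₀ R)

noncomputable def freeCoverMap (N : ModuleCat.{u} R) : freeCover N →ₗ[R] N :=
  Finsupp.linearCombination R (id : N → N)

/-- The kernel of the canonical free cover of `N`. -/
noncomputable def syzygy (N : ModuleCat.{u} R) : ModuleCat.{u} R :=
  ModuleCat.of R (LinearMap.ker (freeCoverMap N))

noncomputable def syzygyMap (N : ModuleCat.{u} R) : syzygy N →ₗ[R] freeCover N :=
  (LinearMap.ker (freeCoverMap N)).subtype

lemma isShortExact_syzygy (N : ModuleCat.{u} R) :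
    IsShortExact (syzygyMap N) (freeCoverMap N) :=
  ⟨Subtype.val_injective, LinearMap.exact_subtype_ker_map (freeCoverMap N),
    Finsupp.linearCombination_id_surjective R N⟩

lemma projective_freeCover (N : ModuleCat.{u} R) : Module.Projective R (freeCover N) :=
  inferInstanceAs (Module.Projective R (N →₀ R))

lemma IsShortExact.extVanishes_right (h : IsShortExact f g) (hA : ExtVanishes A V)
    (hB : ExtVanishes B V) (hf : Function.Surjective (f.lcomp R V)) : ExtVanishes N V := by
  refine extVanishes_of_family (fun N' ↦ N' = N ∨ ExtVanishes N' V) ?_ (Or.inl rfl)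
  rintro N' (rfl | hN')
  · exact ⟨A, B, f, g, h, hB, Or.inr hA, hf⟩
  · have := projective_freeCover N'
    have hP : ExtVanishes (freeCover N') V := extVanishes_of_projective
    have hs := isShortExact_syzygy N'
    exact ⟨_, _, _, _, hs, hP, Or.inr (hs.extVanishes_left hP hN'), hs.surjective_lcomp hN'⟩

end ShortExact

section CharDualExt

variable {R : Type u} [CommRing R]

lemma surjective_lcomp_charDual_iff {A B J : Type u} [AddCommGroup A] [Module R A]
    [AddCommGroup B] [Module R B] [AddCommGroup J] [Module R J] (f : A →ₗ[R] B) :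
    Function.Surjective (f.lcomp R (CharDual R J)) ↔ Function.Injective (f.rTensor J) := by
  constructor
  · intro h
    refine (injective_iff_map_eq_zero _).mpr fun x hx ↦ toBidual_injective (R := R) ?_
    ext1 φ
    obtain ⟨ψ, hψ⟩ := h (TensorProduct.curry φ)
    have hφ : φ = TensorProduct.lift ψ ∘ₗ f.rTensor J := by
      refine TensorProduct.ext' fun a j ↦ ?_
      exact (LinearMap.congr_fun (LinearMap.congr_fun hψ a) j).symm
    have : φ x = 0 := by rw [hφ, LinearMap.comp_apply, hx, map_zero]
    simpa using this
  · intro h a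
    obtain ⟨ψ, hψ⟩ := surjective_lcomp_of_injective h injective_characterModule_self
      (TensorProduct.lift a)
    refine ⟨TensorProduct.curry ψ, LinearMap.ext₂ fun x j ↦ ?_⟩
    exact LinearMap.congr_fun hψ (x ⊗ₜ j)

lemma flat_of_isShortExact_and_pure {A B N : Type u} [AddCommGroup A] [Module R A]
    [AddCommGroup B] [Module R B] [AddCommGroup N] [Module R N]
    {f : A →ₗ[R] B} {g : B →ₗ[R] N} (h : IsShortExact f g) [Module.Flat R N] [Module.Flat R B] :
    Module.Flat R A ∧ ∀ (J : Type u) [AddCommGroup J] [Module R J],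
      Function.Injective (f.rTensor J) := by
  have hp : ∀ (J : Type u) [AddCommGroup J] [Module R J], Function.Injective (f.rTensor J) :=
    fun J _ _ ↦ (LinearMap.lTensor_inj_iff_rTensor_inj J f).mp <|
      LinearMap.lTensor_injective_of_exact_of_flat g h.2.2 f h.1 h.2.1 J
  refine ⟨?_, hp⟩
  rw [Module.Flat.iff_lTensor_preserves_injective_linearMap]
  intro X Y _ _ _ _ i hi
  have hc := (Module.Flat.lTensor_preserves_injective_linearMap (M := B) i hi).comp (hp X)
  rw [← LinearMap.coe_comp, LinearMap.lTensor_comp_rTensor, ← LinearMap.rTensor_comp_lTensor,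
    LinearMap.coe_comp] at hc
  exact hc.of_comp

lemma extVanishes_charDual_of_flat {F : ModuleCat.{u} R} (hF : Module.Flat R F)
    (J : Type u) [AddCommGroup J] [Module R J] :
    ExtVanishes F (ModuleCat.of R (CharDual R J)) := by
  refine extVanishes_of_family (fun N ↦ Module.Flat R N) (fun N hN ↦ ?_) hF
  have := projective_freeCover N
  have hs := isShortExact_syzygy N
  obtain ⟨h1, h2⟩ := flat_of_isShortExact_and_pure hs
  exact ⟨_, _, _, _, hs, extVanishes_of_projective, h1,
    (surjective_lcomp_charDual_iff _).mpr (h2 J)⟩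

lemma isCotorsion_charDual (J : Type u) [AddCommGroup J] [Module R J] :
    IsCotorsion R (ModuleCat.of R (CharDual R J)) :=
  fun _ hF ↦ (extZero_iff_extVanishes _ _).mpr (extVanishes_charDual_of_flat hF J)

lemma isCFlatCotorsion_bidual [IsNoetherianRing R] {C : ModuleCat.{u} R} [Module.Finite R C]
    {Y : Type u} [AddCommGroup Y] [Module R Y] (hY : IsCFlat R C (ModuleCat.of R Y)) :
    IsCFlatCotorsion R C (ModuleCat.of R (CharDual R (CharDual R Y))) := by
  obtain ⟨F, hF, ⟨e⟩⟩ := hY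
  obtain ⟨κ, -⟩ := exists_bidual_equiv e
  exact ⟨ModuleCat.of R (CharDual R (CharDual R F)), flat_bidual (F := F),
    isCotorsion_charDual _, ⟨κ⟩⟩

/-- `f` stays injective after tensoring with any `C`-injective module. -/
def TensorInjective (C : ModuleCat.{u} R) {A B : Type u} [AddCommGroup A] [Module R A]
    [AddCommGroup B] [Module R B] (f : A →ₗ[R] B) : Prop :=
  ∀ J : ModuleCat.{u} R, IsCInjective R C J → Function.Injective (f.rTensor J)

/-- `Ext^i(N, -)` vanishes for `i ≥ 1` on the character duals of `C`-injective modules. -/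
def CharExtVanishes (C N : ModuleCat.{u} R) : Prop :=
  ∀ J : ModuleCat.{u} R, IsCInjective R C J → ExtVanishes N (ModuleCat.of R (CharDual R J))

lemma tensorInjective_of_extVanishes {C : ModuleCat.{u} R} {A B N : ModuleCat.{u} R}
    {f : A →ₗ[R] B} {g : B →ₗ[R] N} (h : IsShortExact f g) (hN : CharExtVanishes C N) :
    TensorInjective C f := fun J hJ ↦
  (surjective_lcomp_charDual_iff f).mp (h.surjective_lcomp (hN J hJ))

lemma charExtVanishes_right {C : ModuleCat.{u} R} {A B N : ModuleCat.{u} R}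
    {f : A →ₗ[R] B} {g : B →ₗ[R] N} (h : IsShortExact f g) (hA : CharExtVanishes C A)
    (hB : CharExtVanishes C B) (hf : TensorInjective C f) : CharExtVanishes C N := fun J hJ ↦
  h.extVanishes_right (hA J hJ) (hB J hJ) ((surjective_lcomp_charDual_iff f).mpr (hf J hJ))

lemma injective_rTensor_of_equiv {A B J J' : Type u} [AddCommGroup A] [Module R A]
    [AddCommGroup B] [Module R B] [AddCommGroup J] [Module R J] [AddCommGroup J'] [Module R J']
    (f : A →ₗ[R] B) (e : J ≃ₗ[R] J') (h : Function.Injective (f.rTensor J')) :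
    Function.Injective (f.rTensor J) := by
  have hc := h.comp (e.lTensor A).injective
  have heq : f.rTensor J' ∘ₗ (e.lTensor A).toLinearMap =
      (e.lTensor B).toLinearMap ∘ₗ f.rTensor J := by
    ext
    simp
  have h' : Function.Injective ((e.lTensor B).toLinearMap ∘ₗ f.rTensor J) := by
    rw [← heq]
    exact hc
  exact Function.Injective.of_comp h'

lemma injective_rTensor_lTensor_of_flat {E A B J : Type u} [AddCommGroup A] [Module R A]
    [AddCommGroup B] [Module R B] [AddCommGroup J] [Module R J] [AddCommGroup E] [Module R E]
    [Module.Flat R E] (f : A →ₗ[R] B) (h : Function.Injective (f.rTensor J)) :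
    Function.Injective ((f.lTensor E).rTensor J) := by
  have hc := (Module.Flat.lTensor_preserves_injective_linearMap (M := E) _ h).comp
    (TensorProduct.assoc R E A J).injective
  have heq : (f.rTensor J).lTensor E ∘ₗ (TensorProduct.assoc R E A J).toLinearMap =
      (TensorProduct.assoc R E B J).toLinearMap ∘ₗ (f.lTensor E).rTensor J := by
    ext
    simp
  have h' : Function.Injective
      ((TensorProduct.assoc R E B J).toLinearMap ∘ₗ (f.lTensor E).rTensor J) := by
    rw [← heq]
    exact hc
  exact Function.Injective.of_comp h'

lemma charExtVanishes_of_isCFlat [IsNoetherianRing R] {C X : ModuleCat.{u} R}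
    (hC : IsSemidualizing R C) (hX : IsCFlat R C X) : CharExtVanishes C X := by
  obtain ⟨E, hE, ⟨e⟩⟩ := hX
  rintro J ⟨I, hI, ⟨j⟩⟩
  refine extVanishes_of_family (fun N ↦ ∃ A : ModuleCat.{u} R, Module.Finite R A ∧
    ExtVanishes A C ∧ Nonempty (N ≃ₗ[R] E ⊗[R] A)) ?_
    ⟨C, hC.1, (extZero_iff_extVanishes C C).mp hC.2.2, ⟨e⟩⟩
  rintro N ⟨A, hA, hAC, ⟨a⟩⟩
  obtain ⟨n, p, hp⟩ := Module.Finite.exists_fin' R A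
  let K := ModuleCat.of R (LinearMap.ker p)
  let P := ModuleCat.of R (Fin n → R)
  let i : K →ₗ[R] P := (LinearMap.ker p).subtype
  have : Module.Projective R P := inferInstanceAs (Module.Projective R (Fin n → R))
  have : Module.Finite R K := inferInstanceAs (Module.Finite R (LinearMap.ker p))
  have : Module.Finite R P := inferInstanceAs (Module.Finite R (Fin n → R))
  have hs : IsShortExact (A := K) (B := P) i p :=
    ⟨Subtype.val_injective, LinearMap.exact_subtype_ker_map p, hp⟩
  have hKC : ExtVanishes K C := hs.extVanishes_left (A := K) (B := P) extVanishes_of_projective hAC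
  refine ⟨ModuleCat.of R (E ⊗[R] K), ModuleCat.of R (E ⊗[R] P), i.lTensor E,
    a.symm.toLinearMap ∘ₗ LinearMap.lTensor E (N := P) p, ⟨?_, ?_, ?_⟩, ?_, ?_, ?_⟩
  · exact Module.Flat.lTensor_preserves_injective_linearMap (M := E) i hs.1
  · have := lTensor_exact E (f := i) (g := p) hs.2.1 hs.2.2
    exact this.comp_injective _ a.symm.injective (map_zero a.symm)
  · exact a.symm.surjective.comp (LinearMap.lTensor_surjective E hp)
  · exact extVanishes_charDual_of_flat (inferInstanceAs (Module.Flat R (E ⊗[R] P))) J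
  · exact ⟨K, inferInstance, hKC, ⟨LinearEquiv.refl R _⟩⟩
  · refine (surjective_lcomp_charDual_iff _).mpr (injective_rTensor_lTensor_of_flat i ?_)
    exact injective_rTensor_of_equiv i j
      (injective_rTensor_hom_of_surjective_lcomp hI i (hs.surjective_lcomp (A := K) (B := P) hAC))

end CharDualExt

section Splicing

variable {R : Type u} [CommRing R]

section

variable {X Y Z : Type u} [AddCommGroup X] [Module R X] [AddCommGroup Y] [Module R Y]
  [AddCommGroup Z] [Module R Z] {a : X →ₗ[R] Y} {b : Y →ₗ[R] Z}

/-- The map `Y / im a → Z` induced by `b` when `b ∘ a = 0`. -/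
def cokerMap (h : b ∘ₗ a = 0) : (Y ⧸ LinearMap.range a) →ₗ[R] Z :=
  (LinearMap.range a).liftQ b (LinearMap.range_le_ker_iff.mpr h)

lemma cokerMap_comp_mkQ (h : b ∘ₗ a = 0) : cokerMap h ∘ₗ (LinearMap.range a).mkQ = b :=
  Submodule.liftQ_mkQ _ _ _

lemma injective_cokerMap (h : Function.Exact a b) :
    Function.Injective (cokerMap h.linearMap_comp_eq_zero) := by
  refine LinearMap.ker_eq_bot.mp (Submodule.ker_liftQ_eq_bot _ _ _ ?_)
  exact (LinearMap.exact_iff.mp h).le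

lemma isShortExact_cokerMap (h : Function.Exact a b) :
    IsShortExact (cokerMap h.linearMap_comp_eq_zero) (LinearMap.range b).mkQ := by
  refine ⟨injective_cokerMap h, ?_, Submodule.mkQ_surjective _⟩
  rw [LinearMap.exact_iff, Submodule.ker_mkQ]
  exact (Submodule.range_liftQ _ _ _).symm

lemma injective_rTensor_cokerMap (h : b ∘ₗ a = 0) {J : Type u} [AddCommGroup J] [Module R J]
    (hJ : Function.Exact (a.rTensor J) (b.rTensor J)) :
    Function.Injective ((cokerMap h).rTensor J) := by
  refine (injective_iff_map_eq_zero _).mpr fun w hw ↦ ?_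
  obtain ⟨y, rfl⟩ := LinearMap.rTensor_surjective J
    (LinearMap.range a).mkQ_surjective w
  rw [← LinearMap.rTensor_comp_apply, cokerMap_comp_mkQ] at hw
  obtain ⟨x, rfl⟩ := (hJ y).mp hw
  rw [← LinearMap.rTensor_comp_apply, LinearMap.range_mkQ_comp, LinearMap.rTensor_zero,
    LinearMap.zero_apply]

lemma exact_comp_of_injective {W : Type u} [AddCommGroup W] [Module R W] {i : Z →ₗ[R] W}
    (h : Function.Exact a b) (hi : Function.Injective i) : Function.Exact a (i ∘ₗ b) :=
  h.comp_injective i hi (map_zero i)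

lemma exact_rTensor_toBidual_comp {J : Type u} [AddCommGroup J] [Module R J]
    (hJ : Function.Exact (a.rTensor J) (b.rTensor J)) :
    Function.Exact (a.rTensor J) ((toBidual R Z ∘ₗ b).rTensor J) := by
  rw [LinearMap.rTensor_comp]
  exact exact_comp_of_injective hJ (injective_rTensor_toBidual J)

lemma exists_of_square_eq_zero {E E' G : Type*} [AddCommGroup E] [Module R E]
    [AddCommGroup E'] [Module R E'] [AddCommGroup G] [Module R G]
    {X Y Z : Type*} [AddCommGroup X] [Module R X] [AddCommGroup Y] [Module R Y]
    [AddCommGroup Z] [Module R Z] {a : X →ₗ[R] Y} {b : Y →ₗ[R] Z}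
    {i : Y →ₗ[R] E} {i' : Z →ₗ[R] E'} {β : E →ₗ[R] E'} {q : E →ₗ[R] G}
    (hab : Function.Exact a b) (hiq : Function.Exact i q) (hi' : Function.Injective i')
    (hβ : ∀ y, β (i y) = i' (b y)) {w : E} (hw : β w = 0) (hqw : q w = 0) :
    ∃ x, i (a x) = w := by
  obtain ⟨y, rfl⟩ := (hiq w).mp hqw
  rw [hβ, map_eq_zero_iff i' hi'] at hw
  obtain ⟨x, rfl⟩ := (hab y).mp hw
  exact ⟨x, rfl⟩

variable (a) in
/-- The cokernel of the composite `X → Y → Y**`. -/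
abbrev BidualCoker : Type u :=
  CharDual R (CharDual R Y) ⧸ LinearMap.range (toBidual R Y ∘ₗ a)

variable (R Y) in
/-- The cokernel of `Y → Y**`. -/
abbrev BidualQuotient : Type u :=
  CharDual R (CharDual R Y) ⧸ LinearMap.range (toBidual R Y)

variable (b) in
def bidualProd : CharDual R (CharDual R Y) →ₗ[R]
    CharDual R (CharDual R Z) × BidualQuotient R Y :=
  (bidualMap b).prod (LinearMap.range (toBidual R Y)).mkQ

lemma exact_bidualProd (h : Function.Exact a b) :
    Function.Exact (toBidual R Y ∘ₗ a) (bidualProd b) := by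
  have hb := LinearMap.congr_fun (bidualMap_comp_toBidual b)
  intro w
  constructor
  · intro hw
    exact exists_of_square_eq_zero h (LinearMap.exact_map_mkQ_range (toBidual R Y))
      (toBidual_injective (R := R) (X := Z)) hb (congrArg Prod.fst hw) (congrArg Prod.snd hw)
  · rintro ⟨x, rfl⟩
    refine Prod.ext ((hb (a x)).trans ?_) ?_
    · rw [LinearMap.comp_apply, h.apply_apply_eq_zero, map_zero]
      rfl
    · exact (Submodule.Quotient.mk_eq_zero _).mpr ⟨a x, rfl⟩

lemma exact_rTensor_bidualProd (h : Function.Exact a b) {J : Type u} [AddCommGroup J] [Module R J]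
    (hJ : Function.Exact (a.rTensor J) (b.rTensor J)) :
    Function.Exact ((toBidual R Y ∘ₗ a).rTensor J) ((bidualProd b).rTensor J) := by
  have hb : ∀ y, (bidualMap b).rTensor J ((toBidual R Y).rTensor J y) =
      (toBidual R Z).rTensor J (b.rTensor J y) := by
    intro y
    rw [← LinearMap.rTensor_comp_apply, bidualMap_comp_toBidual, LinearMap.rTensor_comp_apply]
  intro w
  constructor
  · intro hw
    have h1 : (bidualMap b).rTensor J w = 0 := by
      have : bidualMap b = LinearMap.fst R _ _ ∘ₗ bidualProd b := rfl
      rw [this, LinearMap.rTensor_comp_apply, hw, map_zero]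
    have h2 : (LinearMap.range (toBidual R Y)).mkQ.rTensor J w = 0 := by
      have : (LinearMap.range (toBidual R Y)).mkQ = LinearMap.snd R _ _ ∘ₗ bidualProd b := rfl
      rw [this, LinearMap.rTensor_comp_apply, hw, map_zero]
    obtain ⟨x, hx⟩ := exists_of_square_eq_zero hJ (rTensor_exact J
      (LinearMap.exact_map_mkQ_range (toBidual R Y)) (Submodule.mkQ_surjective _))
      (injective_rTensor_toBidual J) hb h1 h2
    exact ⟨x, by rw [← hx, LinearMap.rTensor_comp_apply]⟩
  · rintro ⟨x, rfl⟩
    rw [← LinearMap.rTensor_comp_apply, (exact_bidualProd h).linearMap_comp_eq_zero,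
      LinearMap.rTensor_zero, LinearMap.zero_apply]

lemma bidualMap_toBidual (b : Y →ₗ[R] Z) (y : Y) :
    bidualMap b (toBidual R Y y) = toBidual R Z (b y) :=
  LinearMap.congr_fun (bidualMap_comp_toBidual b) y

variable (b) in
/-- The map `(e', [e]) ↦ [e' - b** e]`. -/
def bidualDiff : CharDual R (CharDual R Z) × BidualQuotient R Y →ₗ[R] BidualCoker b :=
  (LinearMap.range (toBidual R Z ∘ₗ b)).mkQ ∘ₗ LinearMap.fst R _ _ -
    (LinearMap.range (toBidual R Y)).liftQ
      ((LinearMap.range (toBidual R Z ∘ₗ b)).mkQ ∘ₗ bidualMap b) (by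
        rintro _ ⟨y, rfl⟩
        rw [LinearMap.mem_ker, LinearMap.comp_apply, bidualMap_toBidual]
        exact (Submodule.Quotient.mk_eq_zero _).mpr ⟨y, rfl⟩) ∘ₗ LinearMap.snd R _ _

lemma bidualDiff_mk (e' : CharDual R (CharDual R Z)) (e : CharDual R (CharDual R Y)) :
    bidualDiff b (e', Submodule.Quotient.mk e) = Submodule.Quotient.mk (e' - bidualMap b e) :=
  rfl

lemma isShortExact_bidualDiff (h : Function.Exact a b) :
    IsShortExact (cokerMap (exact_bidualProd h).linearMap_comp_eq_zero) (bidualDiff b) := by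
  refine ⟨injective_cokerMap (exact_bidualProd h), ?_, ?_⟩
  · rintro ⟨e', e⟩
    obtain ⟨e, rfl⟩ := Submodule.Quotient.mk_surjective _ e
    constructor
    · intro he
      rw [bidualDiff_mk, Submodule.Quotient.mk_eq_zero] at he
      obtain ⟨y, hy⟩ := he
      refine ⟨Submodule.Quotient.mk (e + toBidual R Y y), Prod.ext ?_ ?_⟩
      · change bidualMap b (e + toBidual R Y y) = e'
        rw [map_add, bidualMap_toBidual]
        change toBidual R Z (b y) = _ at hy
        rw [hy]
        abel
      · change Submodule.Quotient.mk (e + toBidual R Y y) = Submodule.Quotient.mk e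
        rw [Submodule.Quotient.eq]
        exact ⟨y, by abel⟩
    · rintro ⟨x, hx⟩
      obtain ⟨x, rfl⟩ := Submodule.Quotient.mk_surjective _ x
      rw [← hx]
      change bidualDiff b (bidualMap b x, Submodule.Quotient.mk x) = 0
      rw [bidualDiff_mk, sub_self, Submodule.Quotient.mk_zero]
  · intro z
    obtain ⟨e, rfl⟩ := Submodule.Quotient.mk_surjective _ z
    exact ⟨(e, 0), by
      rw [← Submodule.Quotient.mk_zero, bidualDiff_mk, map_zero, sub_zero]⟩

end

lemma exact_comp_comp {B' A B N D : Type*} [AddCommGroup B']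
    [Module R B'] [AddCommGroup A] [Module R A] [AddCommGroup B] [Module R B]
    [AddCommGroup N] [Module R N] [AddCommGroup D] [Module R D] {g' : B' →ₗ[R] A}
    {f : A →ₗ[R] B} {g : B →ₗ[R] N} {f' : N →ₗ[R] D} (hg' : Function.Surjective g')
    (h : Function.Exact f g) (hf' : Function.Injective f') :
    Function.Exact (f ∘ₗ g') (f' ∘ₗ g) :=
  (hg'.comp_exact_iff_exact (f := f) (g := f' ∘ₗ g)).mpr (h.comp_injective f' hf' (map_zero f'))

lemma isGCFlat_of_shortExact {C : ModuleCat.{u} R} (N : ℤ → ModuleCat.{u} R)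
    (h : ∀ k : ℤ, ∃ (X : ModuleCat.{u} R) (f : N (k + 1) →ₗ[R] X) (g : X →ₗ[R] N k),
      IsShortExact f g ∧ TensorInjective C f ∧ (0 ≤ k → Module.Flat R X) ∧
      (k < 0 → IsCFlat R C X)) : IsGCFlat R C (N 0) := by
  choose X f g hfg ht hF hC using h
  let Z : ZComplex R :=
    { X := X
      d := fun k ↦ f k ∘ₗ g (k + 1)
      d_comp_d := fun k ↦ by
        ext x
        simp [(hfg (k + 1)).2.1.apply_apply_eq_zero] }
  refine ⟨Z, fun k ↦ ?_, hF, hC, fun J hJ k ↦ ?_, ?_⟩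
  · change Function.Exact (f (k + 1) ∘ₗ g (k + 1 + 1)) (f k ∘ₗ g (k + 1))
    exact exact_comp_comp (hfg (k + 1 + 1)).2.2 (hfg (k + 1)).2.1 (hfg k).1
  · change Function.Exact ((f (k + 1) ∘ₗ g (k + 1 + 1)).rTensor J)
      ((f k ∘ₗ g (k + 1)).rTensor J)
    rw [LinearMap.rTensor_comp, LinearMap.rTensor_comp]
    exact exact_comp_comp (LinearMap.rTensor_surjective J (hfg (k + 1 + 1)).2.2)
      (rTensor_exact J (hfg (k + 1)).2.1 (hfg (k + 1)).2.2) (ht k J hJ)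
  · have : Function.Exact (Z.d 0) (g 0) := 
      ((hfg (0 + 1)).2.2.comp_exact_iff_exact (f := f 0) (g := g 0)).mpr (hfg 0).2.1
    exact ⟨(this.linearEquivOfSurjective (hfg 0).2.2).symm⟩

/-- The iterated syzygies of `N`. -/
noncomputable def iterSyzygy (N : ModuleCat.{u} R) : ℕ → ModuleCat.{u} R
  | 0 => N
  | n + 1 => syzygy (iterSyzygy N n)

lemma charExtVanishes_iterSyzygy {C N : ModuleCat.{u} R} (hN : CharExtVanishes C N) (n : ℕ) :
    CharExtVanishes C (iterSyzygy N n) := by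
  induction n with
  | zero => exact hN
  | succ n ih =>
    have := projective_freeCover (iterSyzygy N n)
    exact fun J hJ ↦ (isShortExact_syzygy _).extVanishes_left extVanishes_of_projective (ih J hJ)

/-- The sequence with entries `Ω^n (L (-1))` in degree `n ≥ 0` and `L (k - 1)` in degree
`k < 0`. -/
noncomputable def splicedSequence (L : ℤ → ModuleCat.{u} R) : ℤ → ModuleCat.{u} R
  | Int.ofNat n => iterSyzygy (L (Int.negSucc 0)) n
  | Int.negSucc n => L (Int.negSucc (n + 1))

lemma isGCFlat_of_left_shortExact {C : ModuleCat.{u} R} (L : ℤ → ModuleCat.{u} R)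
    (h0 : CharExtVanishes C (L (-1)))
    (h : ∀ k l : ℤ, k + 1 = l → l < 0 →
      ∃ (X : ModuleCat.{u} R) (f : L l →ₗ[R] X) (g : X →ₗ[R] L k),
        IsShortExact f g ∧ TensorInjective C f ∧ IsCFlat R C X) : IsGCFlat R C (L (-1)) := by
  refine isGCFlat_of_shortExact (splicedSequence L) fun k ↦ ?_
  match k with
  | Int.ofNat n =>
    let S := iterSyzygy (L (Int.negSucc 0)) n
    have hp := projective_freeCover S
    have hS : ∃ (X : ModuleCat.{u} R) (f : syzygy S →ₗ[R] X) (g : X →ₗ[R] S),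
        IsShortExact f g ∧ TensorInjective C f ∧ (0 ≤ Int.ofNat n → Module.Flat R X) ∧
        (Int.ofNat n < 0 → IsCFlat R C X) :=
      ⟨freeCover S, syzygyMap S, freeCoverMap S, isShortExact_syzygy S,
        tensorInjective_of_extVanishes (isShortExact_syzygy S) (charExtVanishes_iterSyzygy h0 n),
        fun _ ↦ inferInstance, fun hn ↦ absurd hn (by simp)⟩
    exact hS
  | Int.negSucc 0 =>
    obtain ⟨X, f, g, hs, ht, hX⟩ := h (Int.negSucc 1) (Int.negSucc 0) rfl (by decide)
    exact ⟨X, f, g, hs, ht, fun hn ↦ absurd hn (by decide), fun _ ↦ hX⟩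
  | Int.negSucc (n + 1) =>
    obtain ⟨X, f, g, hs, ht, hX⟩ := h (Int.negSucc (n + 2)) (Int.negSucc (n + 1)) rfl
      (Int.negSucc_lt_zero _)
    exact ⟨X, f, g, hs, ht, fun hn ↦ absurd hn (by simp), fun _ ↦ hX⟩

lemma charExtVanishes_coker {C : ModuleCat.{u} R} {Z : ZComplex R} (hZ : Z.IsExact)
    (hF : ∀ i : ℤ, 0 ≤ i → Module.Flat R (Z.X i))
    (hT : ∀ J : ModuleCat.{u} R, IsCInjective R C J → Z.TensorExact J) {n : ℤ} (hn : 0 ≤ n) :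
    CharExtVanishes C (ModuleCat.of R (Z.X n ⧸ LinearMap.range (Z.d n))) := by
  intro J hJ
  refine extVanishes_of_family (fun N ↦ ∃ k : ℤ, 0 ≤ k ∧
    N = ModuleCat.of R (Z.X k ⧸ LinearMap.range (Z.d k))) ?_ ⟨n, hn, rfl⟩
  rintro _ ⟨k, hk, rfl⟩
  exact ⟨ModuleCat.of R (Z.X (k + 1) ⧸ LinearMap.range (Z.d (k + 1))), Z.X k, _, _,
    isShortExact_cokerMap (hZ k), extVanishes_charDual_of_flat (hF k hk) J,
    ⟨k + 1, by lia, rfl⟩,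
    (surjective_lcomp_charDual_iff _).mpr (injective_rTensor_cokerMap _ (hT J hJ k))⟩

end Splicing

end GCFlat

/-- Every `G_C`-flat module `M` embeds in a short exact sequence
`0 → M → W → M' → 0` with `W` `C`-flat `C`-cotorsion and `M'` `G_C`-flat. -/
theorem stmt4 (R : Type u) [CommRing R] [IsNoetherianRing R]
    (C : ModuleCat.{u} R) (hC : IsSemidualizing R C) (M : ModuleCat.{u} R)
    (hM : IsGCFlat R C M) :
    ∃ (W M' : ModuleCat.{u} R) (f : ↥M →ₗ[R] ↥W) (g : ↥W →ₗ[R] ↥M'),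
      Function.Injective f ∧ Function.Surjective g ∧ Function.Exact f g ∧
      IsCFlatCotorsion R C W ∧ IsGCFlat R C M' := by
  obtain ⟨Z, hZ, hF, hCF, hT, he⟩ := hM
  obtain ⟨e⟩ : Nonempty (M ≃ₗ[R] (Z.X (-1 + 1) ⧸ LinearMap.range (Z.d (-1 + 1)))) := by
    rw [show (-1 + 1 : ℤ) = 0 from rfl]
    exact he
  have hfin : Module.Finite R C := hC.1
  have hex := fun k : ℤ ↦ GCFlat.exact_comp_of_injective (hZ k)
    (GCFlat.toBidual_injective (R := R) (X := Z.X k))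
  let L : ℤ → ModuleCat.{u} R := fun k ↦ ModuleCat.of R (GCFlat.BidualCoker (Z.d k))
  let W : ModuleCat.{u} R := ModuleCat.of R (GCFlat.CharDual R (GCFlat.CharDual R (Z.X (-1))))
  let N : ModuleCat.{u} R := ModuleCat.of R (Z.X (-1 + 1) ⧸ LinearMap.range (Z.d (-1 + 1)))
  let f : N →ₗ[R] W := GCFlat.cokerMap (hex (-1)).linearMap_comp_eq_zero
  let g : W →ₗ[R] L (-1) := (LinearMap.range (GCFlat.toBidual R (Z.X (-1)) ∘ₗ Z.d (-1))).mkQ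
  have hs : GCFlat.IsShortExact f g := GCFlat.isShortExact_cokerMap (hex (-1))
  have hW : IsCFlat R C W := GCFlat.isCFlat_bidual (hCF (-1) (by decide))
  have hf : GCFlat.TensorInjective C f := fun J hJ ↦
    GCFlat.injective_rTensor_cokerMap _ (GCFlat.exact_rTensor_toBidual_comp (hT J hJ (-1)))
  refine ⟨W, L (-1), f ∘ₗ e.toLinearMap, g, hs.1.comp e.injective, hs.2.2,
    (e.surjective.comp_exact_iff_exact (f := f) (g := g)).mpr hs.2.1,
    GCFlat.isCFlatCotorsion_bidual (hCF (-1) (by decide)), ?_⟩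
  refine GCFlat.isGCFlat_of_left_shortExact L
    (GCFlat.charExtVanishes_right hs (GCFlat.charExtVanishes_coker hZ hF hT (by decide))
      (GCFlat.charExtVanishes_of_isCFlat hC hW) hf) ?_
  rintro k _ rfl hk
  exact ⟨ModuleCat.of R (GCFlat.CharDual R (GCFlat.CharDual R (Z.X k)) ×
      GCFlat.BidualQuotient R (Z.X (k + 1))), _, GCFlat.bidualDiff (Z.d k),
    GCFlat.isShortExact_bidualDiff (hZ k),
    fun J hJ ↦ GCFlat.injective_rTensor_cokerMap _
      (GCFlat.exact_rTensor_bidualProd (hZ k) (hT J hJ k)),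
    GCFlat.isCFlat_prod (GCFlat.isCFlat_bidual (hCF k (by lia)))
      (GCFlat.isCFlat_bidual_quotient (hCF (k + 1) hk))⟩
end
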